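/- arXiv:1206.5209 — 2 statements merged into one kernel-verified Lean document; each statement's English description precedes it below -/
import Mathlib

section
/- Carleman inequality (Proposition 1.4): There exist C > 0 and s0 > 0 such that for every T > 0, every a ≥ 0, every ε ∈ (0,1), every s ≥ s0 ( ε^{−1}(T + T²) + a^{1/2} ε^{−1/2} T² ), and every classical solution φ of (S'^a), the following holds: s³ ∫∫_Q w³ e^{−2sα} |φ|² dx dt + s³ ∫_0^T [ (w³ e^{−2sα} |φ|²)(t,0) + (w³ e^{−2sα} |φ|²)(t,−1) ] dt ≤ C s⁷ ∫_0^T e^{−4sα(t,0) + 2sα(t,−1)} w(t,0)⁷ |φ(t,0)|² dt. -/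
open Real MeasureTheory intervalIntegral Set

noncomputable section

/-- A classical solution of the one-dimensional adjoint system `(S'^a)`:
`φ ∈ C^∞`, satisfying `∂_t φ + ∂_x φ + ε ∂_x² φ − a φ = 0` on `Q = (0,T)×(−1,0)`,
the boundary condition `ε(∂_t φ(t,0) − ∂_x φ(t,0)) − φ(t,0) = 0` and
`∂_t φ(t,−1) + ∂_x φ(t,−1) = 0` for `t ∈ (0,T)`. -/
def IsAdjSol1D (T ε a : ℝ) (φ : ℝ → ℝ → ℝ) : Prop :=
  ContDiff ℝ (⊤ : ℕ∞) (fun p : ℝ × ℝ => φ p.1 p.2) ∧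
  (∀ t ∈ Set.Ioo (0:ℝ) T, ∀ x ∈ Set.Ioo (-1:ℝ) 0,
    deriv (fun s => φ s x) t + deriv (fun y => φ t y) x
      + ε * deriv (deriv (fun y => φ t y)) x - a * φ t x = 0) ∧
  (∀ t ∈ Set.Ioo (0:ℝ) T,
    ε * (deriv (fun s => φ s 0) t - deriv (fun y => φ t y) 0) - φ t 0 = 0) ∧
  (∀ t ∈ Set.Ioo (0:ℝ) T,
    deriv (fun s => φ s (-1)) t + deriv (fun y => φ t y) (-1) = 0)

/-- The squared `X¹`-norm: `‖ψ‖²_{X¹} = ∫_{−1}^0 |ψ|² + ε(|ψ(0)|² + |ψ(−1)|²)`. -/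
def X1normSq (ε : ℝ) (ψ : ℝ → ℝ) : ℝ :=
  (∫ x in (-1:ℝ)..0, ψ x ^ 2) + ε * (ψ 0 ^ 2 + ψ (-1) ^ 2)

/-- Carleman weight `α(t,x) = (e³ − e^{2+x})/(t(T−t))`. -/
def carlA (T t x : ℝ) : ℝ := (Real.exp 3 - Real.exp (2 + x)) / (t * (T - t))

/-- Carleman weight `w(t,x) = e^{2+x}/(t(T−t))` (denoted `φ` in the paper). -/
def carlW (T t x : ℝ) : ℝ := Real.exp (2 + x) / (t * (T - t))

namespace AdjCarleman

/-- Partial derivative in the first (time) variable. -/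
def dt (f : ℝ → ℝ → ℝ) (t x : ℝ) : ℝ := deriv (fun s => f s x) t

/-- Partial derivative in the second (space) variable. -/
def dx (f : ℝ → ℝ → ℝ) (t x : ℝ) : ℝ := deriv (fun y => f t y) x

/-- Joint smoothness on the strip `U × ℝ`. -/
def Sm (U : Set ℝ) (f : ℝ → ℝ → ℝ) : Prop :=
  ContDiffOn ℝ (⊤ : ℕ∞) (fun p : ℝ × ℝ => f p.1 p.2) (U ×ˢ univ)

section Smooth

variable {U : Set ℝ} {f g : ℝ → ℝ → ℝ} {t x : ℝ}

lemma Sm.add (hf : Sm U f) (hg : Sm U g) : Sm U (fun t x => f t x + g t x) :=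
  ContDiffOn.add hf hg

lemma Sm.sub (hf : Sm U f) (hg : Sm U g) : Sm U (fun t x => f t x - g t x) :=
  ContDiffOn.sub hf hg

lemma Sm.mul (hf : Sm U f) (hg : Sm U g) : Sm U (fun t x => f t x * g t x) :=
  ContDiffOn.mul hf hg

lemma Sm.const (c : ℝ) : Sm U (fun _ _ => c) := contDiffOn_const

lemma Sm.of_time {l : ℝ → ℝ} (hl : ContDiffOn ℝ (⊤ : ℕ∞) l U) : Sm U (fun t _ => l t) :=
  hl.comp contDiffOn_fst (fun _ hp => hp.1)

lemma Sm.of_space {l : ℝ → ℝ} (hl : ContDiff ℝ (⊤ : ℕ∞) l) : Sm U (fun _ x => l x) :=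
  (hl.comp contDiff_snd).contDiffOn

lemma isOpen_strip (hU : IsOpen U) : IsOpen (U ×ˢ (univ : Set ℝ)) := hU.prod isOpen_univ

lemma Sm.contDiffAt (hU : IsOpen U) (hf : Sm U f) (ht : t ∈ U) :
    ContDiffAt ℝ (⊤ : ℕ∞) (fun p : ℝ × ℝ => f p.1 p.2) (t, x) :=
  ContDiffOn.contDiffAt hf ((isOpen_strip hU).mem_nhds ⟨ht, mem_univ _⟩)

lemma Sm.hasFDerivAt (hU : IsOpen U) (hf : Sm U f) (ht : t ∈ U) :
    HasFDerivAt (fun p : ℝ × ℝ => f p.1 p.2)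
      (fderiv ℝ (fun p : ℝ × ℝ => f p.1 p.2) (t, x)) (t, x) :=
  ((hf.contDiffAt hU ht).differentiableAt (by simp)).hasFDerivAt

lemma Sm.hasDerivAt_fderiv_t (hU : IsOpen U) (hf : Sm U f) (ht : t ∈ U) :
    HasDerivAt (fun s => f s x) (fderiv ℝ (fun p : ℝ × ℝ => f p.1 p.2) (t, x) (1, 0)) t :=
  (hf.hasFDerivAt hU ht).comp_hasDerivAt (f := fun s => (s, x)) t
    ((hasDerivAt_id t).prodMk (hasDerivAt_const t x))

lemma Sm.hasDerivAt_fderiv_x (hU : IsOpen U) (hf : Sm U f) (ht : t ∈ U) :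
    HasDerivAt (fun y => f t y) (fderiv ℝ (fun p : ℝ × ℝ => f p.1 p.2) (t, x) (0, 1)) x :=
  (hf.hasFDerivAt hU ht).comp_hasDerivAt (f := fun y => (t, y)) x
    ((hasDerivAt_const x t).prodMk (hasDerivAt_id x))

lemma Sm.dt_eq (hU : IsOpen U) (hf : Sm U f) (ht : t ∈ U) :
    dt f t x = fderiv ℝ (fun p : ℝ × ℝ => f p.1 p.2) (t, x) (1, 0) :=
  (hf.hasDerivAt_fderiv_t hU ht).deriv

lemma Sm.dx_eq (hU : IsOpen U) (hf : Sm U f) (ht : t ∈ U) :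
    dx f t x = fderiv ℝ (fun p : ℝ × ℝ => f p.1 p.2) (t, x) (0, 1) :=
  (hf.hasDerivAt_fderiv_x hU ht).deriv

lemma Sm.hasDerivAt_t (hU : IsOpen U) (hf : Sm U f) (ht : t ∈ U) :
    HasDerivAt (fun s => f s x) (dt f t x) t :=
  hf.dt_eq hU ht ▸ hf.hasDerivAt_fderiv_t hU ht

lemma Sm.hasDerivAt_x (hU : IsOpen U) (hf : Sm U f) (ht : t ∈ U) :
    HasDerivAt (fun y => f t y) (dx f t x) x :=
  hf.dx_eq hU ht ▸ hf.hasDerivAt_fderiv_x hU ht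

lemma Sm.contDiffOn_fderiv (hU : IsOpen U) (hf : Sm U f) (v : ℝ × ℝ) :
    ContDiffOn ℝ (⊤ : ℕ∞) (fun p => fderiv ℝ (fun p : ℝ × ℝ => f p.1 p.2) p v) (U ×ˢ univ) :=
  (ContDiffOn.fderiv_of_isOpen hf (isOpen_strip hU) (m := (⊤ : ℕ∞)) (by simp)).clm_apply
    contDiffOn_const

lemma Sm.dt (hU : IsOpen U) (hf : Sm U f) : Sm U (dt f) :=
  (hf.contDiffOn_fderiv hU (1, 0)).congr fun _ hp => hf.dt_eq hU hp.1

lemma Sm.dx (hU : IsOpen U) (hf : Sm U f) : Sm U (dx f) :=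
  (hf.contDiffOn_fderiv hU (0, 1)).congr fun _ hp => hf.dx_eq hU hp.1

lemma Sm.dt_dx (hU : IsOpen U) (hf : Sm U f) (ht : t ∈ U) :
    AdjCarleman.dt (AdjCarleman.dx f) t x = AdjCarleman.dx (AdjCarleman.dt f) t x := by
  set F := fun p : ℝ × ℝ => f p.1 p.2 with hF
  have hsymm : IsSymmSndFDerivAt ℝ F (t, x) :=
    (hf.contDiffAt hU ht).isSymmSndFDerivAt (by simp; exact WithTop.coe_le_coe.2 le_top)
  have hd : DifferentiableAt ℝ (fderiv ℝ F) (t, x) :=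
    ((ContDiffOn.fderiv_of_isOpen hf (isOpen_strip hU) (m := (⊤ : ℕ∞)) (by simp)).contDiffAt
      ((isOpen_strip hU).mem_nhds ⟨ht, mem_univ _⟩)).differentiableAt (by simp)
  have key : ∀ v : ℝ × ℝ, fderiv ℝ (fun p => fderiv ℝ F p v) (t, x)
      = (fderiv ℝ (fderiv ℝ F) (t, x)).flip v := fun v => by
    have := (hd.hasFDerivAt.clm_apply (hasFDerivAt_const v (t, x))).fderiv
    simpa using this
  have nh : U ×ˢ (univ : Set ℝ) ∈ nhds (t, x) := (isOpen_strip hU).mem_nhds ⟨ht, mem_univ _⟩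
  rw [(hf.dx hU).dt_eq hU ht, (hf.dt hU).dx_eq hU ht]
  have e1 : (fun p : ℝ × ℝ => AdjCarleman.dx f p.1 p.2) =ᶠ[nhds (t, x)]
      fun p => fderiv ℝ F p (0, 1) :=
    Filter.eventually_of_mem nh fun p hp => hf.dx_eq hU hp.1
  have e2 : (fun p : ℝ × ℝ => AdjCarleman.dt f p.1 p.2) =ᶠ[nhds (t, x)]
      fun p => fderiv ℝ F p (1, 0) :=
    Filter.eventually_of_mem nh fun p hp => hf.dt_eq hU hp.1
  rw [e1.fderiv_eq, e2.fderiv_eq, key, key]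
  exact hsymm (1, 0) (0, 1)

lemma Sm.continuousOn (hf : Sm U f) :
    ContinuousOn (fun p : ℝ × ℝ => f p.1 p.2) (U ×ˢ univ) := ContDiffOn.continuousOn hf

lemma Sm.continuous_x (hf : Sm U f) (ht : t ∈ U) : Continuous (fun x => f t x) := by
  have : ContinuousOn (fun x : ℝ => f t x) univ :=
    hf.continuousOn.comp (f := fun x : ℝ => (t, x)) (by fun_prop) (fun x _ => ⟨ht, mem_univ _⟩)
  exact continuousOn_univ.mp this

lemma Sm.integrable_x (hf : Sm U f) (ht : t ∈ U) :
    IntervalIntegrable (fun x => f t x) volume (-1) 0 :=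
  (hf.continuous_x ht).intervalIntegrable _ _

lemma Sm.hasDerivAt_integral (hU : IsOpen U) (hf : Sm U f) (ht : t ∈ U) :
    HasDerivAt (fun t => ∫ x in (-1 : ℝ)..0, f t x)
      (∫ x in (-1 : ℝ)..0, AdjCarleman.dt f t x) t := by
  obtain ⟨δ, hδ, hball⟩ := Metric.nhds_basis_closedBall.mem_iff.mp (hU.mem_nhds ht)
  have hK : IsCompact (Metric.closedBall t δ ×ˢ Icc (-1 : ℝ) 0) :=
    (isCompact_closedBall t δ).prod isCompact_Icc
  obtain ⟨C, hC⟩ := hK.exists_bound_of_continuousOn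
    ((hf.dt hU).continuousOn.mono (prod_mono hball (subset_univ _)))
  have hnh : ∀ᶠ s in nhds t, s ∈ U := hU.mem_nhds ht
  refine (intervalIntegral.hasDerivAt_integral_of_dominated_loc_of_deriv_le
    (bound := fun _ => C) (Metric.closedBall_mem_nhds t hδ) ?_ (hf.integrable_x ht) ?_ ?_
    intervalIntegrable_const ?_).2
  · filter_upwards [hnh] with s hs
    exact (hf.continuous_x hs).aestronglyMeasurable
  · exact ((hf.dt hU).continuous_x ht).aestronglyMeasurable
  · refine Filter.Eventually.of_forall fun x hx s hs => hC (s, x) ⟨hs, ?_⟩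
    rw [uIoc_of_le (by norm_num)] at hx
    exact ⟨hx.1.le, hx.2⟩
  · exact Filter.Eventually.of_forall fun x _ s hs => hf.hasDerivAt_t hU (hball hs)

lemma integral_congr_Ioo {u v : ℝ → ℝ} (h : ∀ x ∈ Ioo (-1 : ℝ) 0, u x = v x) :
    ∫ x in (-1 : ℝ)..0, u x = ∫ x in (-1 : ℝ)..0, v x := by
  rw [intervalIntegral.integral_of_le (by norm_num), intervalIntegral.integral_of_le (by norm_num),
    integral_Ioc_eq_integral_Ioo, integral_Ioc_eq_integral_Ioo]
  exact setIntegral_congr_fun measurableSet_Ioo h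

/-- A balance law `∂ₜ f + ∂ₓ g = h` integrated over `(-1, 0)`. -/
lemma hasDerivAt_integral_of_balance (hU : IsOpen U) (hf : Sm U f) (hg : Sm U g) (ht : t ∈ U)
    {h : ℝ → ℝ} (hb : ∀ x ∈ Ioo (-1 : ℝ) 0, dt f t x + dx g t x = h x) :
    HasDerivAt (fun t => ∫ x in (-1 : ℝ)..0, f t x)
      ((∫ x in (-1 : ℝ)..0, h x) - (g t 0 - g t (-1))) t := by
  have h1 : ∫ x in (-1 : ℝ)..0, dx g t x = g t 0 - g t (-1) :=
    intervalIntegral.integral_eq_sub_of_hasDerivAt (fun x _ => hg.hasDerivAt_x hU ht)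
      ((hg.dx hU).integrable_x ht)
  have h2 : ∫ x in (-1 : ℝ)..0, h x
      = (∫ x in (-1 : ℝ)..0, dt f t x) + ∫ x in (-1 : ℝ)..0, dx g t x := by
    rw [← intervalIntegral.integral_add ((hf.dt hU).integrable_x ht) ((hg.dx hU).integrable_x ht)]
    exact integral_congr_Ioo fun x hx => (hb x hx).symm
  rw [h2, h1, add_sub_cancel_right]
  exact hf.hasDerivAt_integral hU ht

end Smooth

/-- Smooth solutions of the adjoint system for times in `U`. -/
structure Sol (U : Set ℝ) (ε a : ℝ) (u : ℝ → ℝ → ℝ) : Prop where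
  sm : Sm U u
  pde : ∀ t ∈ U, ∀ x ∈ Ioo (-1 : ℝ) 0, dt u t x + dx u t x + ε * dx (dx u) t x - a * u t x = 0
  right : ∀ t ∈ U, ε * (dt u t 0 - dx u t 0) - u t 0 = 0
  left : ∀ t ∈ U, dt u t (-1) + dx u t (-1) = 0

lemma eq_zero_of_hasDerivAt {U : Set ℝ} (hU : IsOpen U) {P : ℝ → ℝ} {d t : ℝ} (ht : t ∈ U)
    (hP : HasDerivAt P d t) (h0 : ∀ s ∈ U, P s = 0) : d = 0 := by
  have h1 : P =ᶠ[nhds t] fun _ => (0 : ℝ) := Filter.eventually_of_mem (hU.mem_nhds ht) h0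
  exact hP.unique ((hasDerivAt_const t (0 : ℝ)).congr_of_eventuallyEq h1)

section Energy

variable {U : Set ℝ} {ε a : ℝ} {u : ℝ → ℝ → ℝ} {t : ℝ}

lemma Sol.deriv_time (hU : IsOpen U) (h : Sol U ε a u) : Sol U ε a (dt u) := by
  have hx := h.sm.dx hU
  have hxx := hx.dx hU
  refine ⟨h.sm.dt hU, fun t ht x hx' => ?_, fun t ht => ?_, fun t ht => ?_⟩
  · have e1 : dx (dx (dt u)) t x = dt (dx (dx u)) t x := by
      rw [hx.dt_dx hU ht]
      have : (fun y => dx (dt u) t y) = fun y => dt (dx u) t y :=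
        funext fun y => (h.sm.dt_dx hU ht).symm
      unfold dx at this ⊢
      rw [this]
    rw [e1, ← h.sm.dt_dx hU ht]
    exact eq_zero_of_hasDerivAt hU ht (((((h.sm.dt hU).hasDerivAt_t hU ht).add
      (hx.hasDerivAt_t hU ht)).add ((hxx.hasDerivAt_t hU ht).const_mul ε)).sub
      ((h.sm.hasDerivAt_t hU ht).const_mul a)) fun s hs => h.pde s hs x hx'
  · rw [← h.sm.dt_dx hU ht]
    exact eq_zero_of_hasDerivAt hU ht (((((h.sm.dt hU).hasDerivAt_t hU ht).sub
      (hx.hasDerivAt_t hU ht)).const_mul ε).sub (h.sm.hasDerivAt_t hU ht)) h.right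
  · rw [← h.sm.dt_dx hU ht]
    exact eq_zero_of_hasDerivAt hU ht (((h.sm.dt hU).hasDerivAt_t hU ht).add
      (hx.hasDerivAt_t hU ht)) h.left

/-- The squared spatial `L²` norm. -/
def nsq (f : ℝ → ℝ → ℝ) (t : ℝ) : ℝ := ∫ x in (-1 : ℝ)..0, f t x ^ 2

lemma nsq_nonneg (f : ℝ → ℝ → ℝ) (t : ℝ) : 0 ≤ nsq f t :=
  intervalIntegral.integral_nonneg (by norm_num) fun _ _ => sq_nonneg _

lemma Sm.sq {f : ℝ → ℝ → ℝ} (hf : Sm U f) : Sm U (fun t x => f t x ^ 2) := ContDiffOn.pow hf 2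

lemma Sm.const_mul {f : ℝ → ℝ → ℝ} (c : ℝ) (hf : Sm U f) : Sm U (fun t x => c * f t x) :=
  (Sm.const c).mul hf

/-- The energy `½ (‖u‖² + ε (u(0)² + u(-1)²))`. -/
def energyZero (ε : ℝ) (u : ℝ → ℝ → ℝ) (t : ℝ) : ℝ :=
  (nsq u t + ε * (u t 0 ^ 2 + u t (-1) ^ 2)) / 2

/-- The energy `½ (ε ‖∂ₓ u‖² + a ‖u‖² + u(0)²)`. -/
def energyOne (ε a : ℝ) (u : ℝ → ℝ → ℝ) (t : ℝ) : ℝ :=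
  (ε * nsq (dx u) t + a * nsq u t + u t 0 ^ 2) / 2

lemma Sol.hasDerivAt_energyZero (hU : IsOpen U) (h : Sol U ε a u) (ht : t ∈ U) :
    HasDerivAt (energyZero ε u)
      (ε * nsq (dx u) t + a * nsq u t + u t 0 ^ 2 / 2 + u t (-1) ^ 2 / 2) t := by
  have hx := h.sm.dx hU
  have hf : Sm U (fun t x => u t x ^ 2) := h.sm.sq
  have hg : Sm U (fun t x => u t x ^ 2 + 2 * ε * (u t x * dx u t x)) :=
    hf.add ((h.sm.mul hx).const_mul _)
  have key := hasDerivAt_integral_of_balance hU hf hg ht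
    (h := fun x => 2 * ε * dx u t x ^ 2 + 2 * a * u t x ^ 2) (fun x hx' => by
      have e1 : dt (fun t x => u t x ^ 2) t x = 2 * u t x * dt u t x := by
        exact (HasDerivAt.congr_deriv ((h.sm.hasDerivAt_t hU ht).pow 2)
          (by push_cast; ring)).deriv
      have e2 : dx (fun t x => u t x ^ 2 + 2 * ε * (u t x * dx u t x)) t x
          = 2 * u t x * dx u t x
            + 2 * ε * (dx u t x * dx u t x + u t x * dx (dx u) t x) := by
        exact (HasDerivAt.congr_deriv (((h.sm.hasDerivAt_x hU ht).pow 2).add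
          (((h.sm.hasDerivAt_x hU ht).mul (hx.hasDerivAt_x hU ht)).const_mul (2 * ε)))
          (by push_cast; ring)).deriv
      rw [e1, e2]
      linear_combination 2 * u t x * h.pde t ht x hx')
  have h_int : ∫ x in (-1 : ℝ)..0, (2 * ε * dx u t x ^ 2 + 2 * a * u t x ^ 2)
      = 2 * ε * nsq (dx u) t + 2 * a * nsq u t := by
    rw [intervalIntegral.integral_add (((hx.sq).const_mul _).integrable_x ht)
      ((hf.const_mul _).integrable_x ht), intervalIntegral.integral_const_mul,
      intervalIntegral.integral_const_mul]
    rfl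
  have hb := (((h.sm.hasDerivAt_t hU ht (x := 0)).pow 2).add
    ((h.sm.hasDerivAt_t hU ht (x := -1)).pow 2)).const_mul ε
  refine ((key.add hb).div_const 2).congr_deriv ?_
  rw [h_int]
  have h0 := h.right t ht
  have h1 := h.left t ht
  push_cast
  linear_combination u t 0 * h0 + u t (-1) * ε * h1

lemma Sol.hasDerivAt_energyOne (hU : IsOpen U) (h : Sol U ε a u) (ht : t ∈ U) :
    HasDerivAt (energyOne ε a u)
      (nsq (dt u) t + (∫ x in (-1 : ℝ)..0, dt u t x * dx u t x)
        + ε * (dt u t 0 ^ 2 + dt u t (-1) ^ 2)) t := by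
  have hx := h.sm.dx hU
  have htt := h.sm.dt hU
  have hf : Sm U (fun t x => ε * dx u t x ^ 2 + a * u t x ^ 2) :=
    (hx.sq.const_mul _).add (h.sm.sq.const_mul _)
  have hg : Sm U (fun t x => -2 * ε * (dx u t x * dt u t x)) := (hx.mul htt).const_mul _
  have key := hasDerivAt_integral_of_balance hU hf hg ht
    (h := fun x => 2 * dt u t x ^ 2 + 2 * (dt u t x * dx u t x)) (fun x hx' => by
      have e1 : dt (fun t x => ε * dx u t x ^ 2 + a * u t x ^ 2) t x
          = ε * (2 * dx u t x * dt (dx u) t x) + a * (2 * u t x * dt u t x) := by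
        exact (HasDerivAt.congr_deriv ((((hx.hasDerivAt_t hU ht).pow 2).const_mul ε).add
          (((h.sm.hasDerivAt_t hU ht).pow 2).const_mul a))
          (by push_cast; ring)).deriv
      have e2 : dx (fun t x => -2 * ε * (dx u t x * dt u t x)) t x
          = -2 * ε * (dx (dx u) t x * dt u t x + dx u t x * dx (dt u) t x) := by
        exact (HasDerivAt.congr_deriv (((hx.hasDerivAt_x hU ht).mul
          (htt.hasDerivAt_x hU ht)).const_mul (-2 * ε))
          (by ring)).deriv
      rw [e1, e2, h.sm.dt_dx hU ht]
      linear_combination -2 * dt u t x * h.pde t ht x hx')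
  have h_int : ∫ x in (-1 : ℝ)..0, (2 * dt u t x ^ 2 + 2 * (dt u t x * dx u t x))
      = 2 * nsq (dt u) t + 2 * ∫ x in (-1 : ℝ)..0, dt u t x * dx u t x := by
    rw [intervalIntegral.integral_add (((htt.sq).const_mul _).integrable_x ht)
      (((htt.mul hx).const_mul _).integrable_x ht), intervalIntegral.integral_const_mul,
      intervalIntegral.integral_const_mul]
    rfl
  have hint2 : ∀ s ∈ U, ∫ x in (-1 : ℝ)..0, (ε * dx u s x ^ 2 + a * u s x ^ 2)
      = ε * nsq (dx u) s + a * nsq u s := fun s hs => by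
    rw [intervalIntegral.integral_add ((hx.sq.const_mul _).integrable_x hs)
      ((h.sm.sq.const_mul _).integrable_x hs), intervalIntegral.integral_const_mul,
      intervalIntegral.integral_const_mul]
    rfl
  have hb := (h.sm.hasDerivAt_t hU ht (x := 0)).pow 2
  refine HasDerivAt.congr_of_eventuallyEq (((key.add hb).div_const 2).congr_deriv ?_)
    (Filter.eventually_of_mem (hU.mem_nhds ht) fun s hs => ?_)
  · rw [h_int]
    have h0 := h.right t ht
    have h1 := h.left t ht
    push_cast
    linear_combination (-dt u t 0) * h0 - dt u t (-1) * ε * h1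
  · simp only [energyOne, Pi.add_apply, Pi.pow_apply, hint2 s hs]

/-- Lower bound for the derivative of `energyOne`, after absorbing the transport term. -/
lemma Sol.energyOne_deriv_ge (hU : IsOpen U) (h : Sol U ε a u) (ht : t ∈ U) :
    nsq (dt u) t / 2 - nsq (dx u) t / 2 + ε * (dt u t 0 ^ 2 + dt u t (-1) ^ 2)
      ≤ nsq (dt u) t + (∫ x in (-1 : ℝ)..0, dt u t x * dx u t x)
        + ε * (dt u t 0 ^ 2 + dt u t (-1) ^ 2) := by
  have hx := h.sm.dx hU
  have htt := h.sm.dt hU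
  have h1 : 0 ≤ ∫ x in (-1 : ℝ)..0, (1 / 2 * dt u t x ^ 2 + 1 / 2 * dx u t x ^ 2
      + dt u t x * dx u t x) :=
    intervalIntegral.integral_nonneg (by norm_num) fun x _ => by
      nlinarith [sq_nonneg (dt u t x + dx u t x)]
  rw [intervalIntegral.integral_add (((htt.sq.const_mul _).add (hx.sq.const_mul _)).integrable_x ht)
      ((htt.mul hx).integrable_x ht), intervalIntegral.integral_add
      ((htt.sq.const_mul _).integrable_x ht) ((hx.sq.const_mul _).integrable_x ht),
      intervalIntegral.integral_const_mul, intervalIntegral.integral_const_mul] at h1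
  change 0 ≤ 1 / 2 * nsq (dt u) t + 1 / 2 * nsq (dx u) t + _ at h1
  linarith

end Energy

/-- The spatial weight `e^{2+x}`. -/
def beta (x : ℝ) : ℝ := Real.exp (2 + x)

/-- The spatial weight `e³ - e^{2+x}`. -/
def eta (x : ℝ) : ℝ := Real.exp 3 - beta x

lemma hasDerivAt_beta (x : ℝ) : HasDerivAt beta (beta x) x :=
  HasDerivAt.congr_deriv ((hasDerivAt_id x).const_add 2).exp (by simp [beta])

lemma hasDerivAt_eta (x : ℝ) : HasDerivAt eta (-beta x) x :=
  (hasDerivAt_beta x).const_sub (Real.exp 3)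

lemma contDiff_beta : ContDiff ℝ (⊤ : ℕ∞) beta := by unfold beta; fun_prop

lemma contDiff_eta : ContDiff ℝ (⊤ : ℕ∞) eta :=
  contDiff_const.sub contDiff_beta

/-- A smooth temporal weight on `U`, with its first two derivatives. -/
structure TimeWeight (U : Set ℝ) (l l₁ l₂ : ℝ → ℝ) : Prop where
  sm : ContDiffOn ℝ (⊤ : ℕ∞) l U
  sm₁ : ContDiffOn ℝ (⊤ : ℕ∞) l₁ U
  hasDeriv : ∀ t ∈ U, HasDerivAt l (l₁ t) t
  hasDeriv₁ : ∀ t ∈ U, HasDerivAt l₁ (l₂ t) t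

section Conjugation

/-- The conjugated function `e^{-λ η} u`. -/
def conj (l : ℝ → ℝ) (u : ℝ → ℝ → ℝ) (t x : ℝ) : ℝ := Real.exp (-(l t * eta x)) * u t x

/-- Zeroth-order coefficient of the conjugated operator. -/
def potential (ε a : ℝ) (l l₁ : ℝ → ℝ) (t x : ℝ) : ℝ :=
  ε * (l t ^ 2 * beta x ^ 2) - l t * beta x + l₁ t * eta x - a

/-- Density of the Carleman functional. -/
def carlDensity (ε a : ℝ) (l l₁ : ℝ → ℝ) (u : ℝ → ℝ → ℝ) (t x : ℝ) : ℝ :=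
  1 / 2 * (potential ε a l l₁ t x * conj l u t x ^ 2) - ε / 2 * dx (conj l u) t x ^ 2

/-- Flux of the Carleman functional. -/
def carlFlux (ε a : ℝ) (l l₁ : ℝ → ℝ) (u : ℝ → ℝ → ℝ) (t x : ℝ) : ℝ :=
  ε * (dx (conj l u) t x * dt (conj l u) t x)
    - ε / 2 * ((2 * ε * (l t * beta x) - 1) * dx (conj l u) t x ^ 2)
    - ε ^ 2 * ((l t * beta x) * (conj l u t x * dx (conj l u) t x))
    + ε ^ 2 / 2 * ((l t * beta x) * conj l u t x ^ 2)
    - 1 / 2 * ((2 * ε * (l t * beta x) - 1) * (potential ε a l l₁ t x * conj l u t x ^ 2))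

/-- Coefficient of `ψ²` in the bulk term of the Carleman identity. -/
def bulk (ε : ℝ) (l l₁ l₂ : ℝ → ℝ) (t x : ℝ) : ℝ :=
  1 / 2 * ((2 * ε * l t ^ 2 * beta x ^ 2 - l t * beta x - l₁ t * beta x)
    * (2 * ε * (l t * beta x) - 1))
  - 1 / 2 * (2 * ε * l t * l₁ t * beta x ^ 2 - l₁ t * beta x + l₂ t * eta x)
  - ε ^ 2 / 2 * (l t * beta x)

variable {U : Set ℝ} {ε a : ℝ} {u : ℝ → ℝ → ℝ} {l l₁ l₂ : ℝ → ℝ} {t x : ℝ}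

lemma TimeWeight.sm_lbeta (hl : TimeWeight U l l₁ l₂) : Sm U (fun t x => l t * beta x) :=
  (Sm.of_time hl.sm).mul (Sm.of_space contDiff_beta)

lemma TimeWeight.sm_conj (hl : TimeWeight U l l₁ l₂) (hu : Sm U u) : Sm U (conj l u) :=
  (ContDiffOn.neg ((Sm.of_time hl.sm).mul (Sm.of_space contDiff_eta))).exp.mul hu

lemma TimeWeight.sm_potential (hl : TimeWeight U l l₁ l₂) : Sm U (potential ε a l l₁) :=
  (((((Sm.of_time hl.sm).sq.mul (Sm.of_space contDiff_beta).sq).const_mul ε).sub hl.sm_lbeta).add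
    ((Sm.of_time hl.sm₁).mul (Sm.of_space contDiff_eta))).sub (Sm.const a)

lemma TimeWeight.sm_carlDensity (hU : IsOpen U) (hl : TimeWeight U l l₁ l₂) (hu : Sm U u) :
    Sm U (carlDensity ε a l l₁ u) :=
  ((hl.sm_potential.mul (hl.sm_conj hu).sq).const_mul _).sub
    (((hl.sm_conj hu).dx hU).sq.const_mul _)

lemma TimeWeight.sm_carlFlux (hU : IsOpen U) (hl : TimeWeight U l l₁ l₂) (hu : Sm U u) :
    Sm U (carlFlux ε a l l₁ u) := by
  have hψ := hl.sm_conj hu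
  have hx := hψ.dx hU
  have hq : Sm U (fun t x => 2 * ε * (l t * beta x) - 1) :=
    (hl.sm_lbeta.const_mul _).sub (Sm.const 1)
  exact (((((hx.mul (hψ.dt hU)).const_mul _).sub ((hq.mul hx.sq).const_mul _)).sub
    ((hl.sm_lbeta.mul (hψ.mul hx)).const_mul _)).add ((hl.sm_lbeta.mul hψ.sq).const_mul _)).sub
    ((hq.mul (hl.sm_potential.mul hψ.sq)).const_mul _)

lemma TimeWeight.dt_conj (hU : IsOpen U) (hl : TimeWeight U l l₁ l₂) (hu : Sm U u) (ht : t ∈ U) :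
    dt (conj l u) t x = Real.exp (-(l t * eta x)) * (dt u t x - l₁ t * eta x * u t x) :=
  (HasDerivAt.congr_deriv ((((hl.hasDeriv t ht).mul_const (eta x)).neg.exp).mul
    (hu.hasDerivAt_t hU ht)) (by simp; ring)).deriv

lemma TimeWeight.dx_conj (hU : IsOpen U) (hu : Sm U u) (ht : t ∈ U) :
    dx (conj l u) t x = Real.exp (-(l t * eta x)) * (dx u t x + l t * beta x * u t x) :=
  (HasDerivAt.congr_deriv ((((hasDerivAt_eta x).const_mul (l t)).neg.exp).mul
    (hu.hasDerivAt_x hU ht)) (by simp; ring)).deriv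

lemma TimeWeight.dx_dx_conj (hU : IsOpen U) (hu : Sm U u) (ht : t ∈ U) :
    dx (dx (conj l u)) t x = Real.exp (-(l t * eta x)) * (dx (dx u) t x
      + 2 * (l t * beta x) * dx u t x + (l t ^ 2 * beta x ^ 2 + l t * beta x) * u t x) := by
  have : (fun y => dx (conj l u) t y)
      = fun y => Real.exp (-(l t * eta y)) * (dx u t y + l t * beta y * u t y) :=
    funext fun y => dx_conj hU hu ht
  change deriv (fun y => dx (conj l u) t y) x = _
  rw [this]
  exact (HasDerivAt.congr_deriv ((((hasDerivAt_eta x).const_mul (l t)).neg.exp).mul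
    (((hu.dx hU).hasDerivAt_x hU ht).add (((hasDerivAt_beta x).const_mul (l t)).mul
    (hu.hasDerivAt_x hU ht)))) (by simp; ring)).deriv

lemma Sol.conj_pde (hU : IsOpen U) (h : Sol U ε a u) (hl : TimeWeight U l l₁ l₂) (ht : t ∈ U)
    (hx : x ∈ Ioo (-1 : ℝ) 0) :
    ε * dx (dx (conj l u)) t x + potential ε a l l₁ t x * conj l u t x
      + (dt (conj l u) t x - (2 * ε * (l t * beta x) - 1) * dx (conj l u) t x
        - ε * (l t * beta x) * conj l u t x) = 0 := by
  rw [TimeWeight.dx_dx_conj hU h.sm ht, TimeWeight.dx_conj hU h.sm ht, hl.dt_conj hU h.sm ht,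
    conj, potential]
  linear_combination Real.exp (-(l t * eta x)) * h.pde t ht x hx

/-- The Carleman identity, integrated in space. -/
lemma Sol.hasDerivAt_carleman (hU : IsOpen U) (h : Sol U ε a u) (hl : TimeWeight U l l₁ l₂)
    (ht : t ∈ U) :
    HasDerivAt (fun t => ∫ x in (-1 : ℝ)..0, carlDensity ε a l l₁ u t x)
      ((∫ x in (-1 : ℝ)..0, -(2 * ε ^ 2 * (l t * beta x) * dx (conj l u) t x ^ 2
          + bulk ε l l₁ l₂ t x * conj l u t x ^ 2
          + (dt (conj l u) t x - (2 * ε * (l t * beta x) - 1) * dx (conj l u) t x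
            - ε * (l t * beta x) * conj l u t x) ^ 2))
        - (carlFlux ε a l l₁ u t 0 - carlFlux ε a l l₁ u t (-1))) t := by
  have hψ := hl.sm_conj h.sm
  have hψx := hψ.dx hU
  refine hasDerivAt_integral_of_balance hU (hl.sm_carlDensity hU h.sm)
    (hl.sm_carlFlux hU h.sm) ht fun x hx => ?_
  have dψt := hψ.hasDerivAt_t hU ht (x := x)
  have dψxt := hψx.hasDerivAt_t hU ht (x := x)
  have dψx := hψ.hasDerivAt_x hU ht (x := x)
  have dψxx := hψx.hasDerivAt_x hU ht (x := x)
  have dψtx := (hψ.dt hU).hasDerivAt_x hU ht (x := x)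
  have dVt : HasDerivAt (fun s => potential ε a l l₁ s x)
      (2 * ε * l t * l₁ t * beta x ^ 2 - l₁ t * beta x + l₂ t * eta x) t :=
    HasDerivAt.congr_deriv ((((((hl.hasDeriv t ht).pow 2).mul_const (beta x ^ 2)).const_mul ε).sub
      ((hl.hasDeriv t ht).mul_const (beta x))).add ((hl.hasDeriv₁ t ht).mul_const (eta x))
      |>.sub_const a) (by push_cast; ring)
  have dVx : HasDerivAt (fun y => potential ε a l l₁ t y)
      (2 * ε * l t ^ 2 * beta x ^ 2 - l t * beta x - l₁ t * beta x) x :=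
    HasDerivAt.congr_deriv ((((((hasDerivAt_beta x).pow 2).const_mul (l t ^ 2)).const_mul ε).sub
      ((hasDerivAt_beta x).const_mul (l t))).add ((hasDerivAt_eta x).const_mul (l₁ t))
      |>.sub_const a) (by push_cast; ring)
  have dp := (hasDerivAt_beta x).const_mul (l t)
  have dq := (dp.const_mul (2 * ε)).sub_const 1
  have e1 := (((dVt.mul (dψt.pow 2)).const_mul (1 / 2)).sub
    ((dψxt.pow 2).const_mul (ε / 2))).deriv
  have e2 := (((((dψxx.mul dψtx).const_mul ε).sub ((dq.mul (dψxx.pow 2)).const_mul (ε / 2))).sub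
    ((dp.mul (dψx.mul dψxx)).const_mul (ε ^ 2))).add
    ((dp.mul (dψx.pow 2)).const_mul (ε ^ 2 / 2))).sub
    ((dq.mul (dVx.mul (dψx.pow 2))).const_mul (1 / 2)) |>.deriv
  change dt (carlDensity ε a l l₁ u) t x = _ at e1
  change dx (carlFlux ε a l l₁ u) t x = _ at e2
  rw [e1, e2, hψ.dt_dx hU ht]
  have hP := h.conj_pde hU hl ht hx
  simp only [bulk, Pi.pow_apply, Pi.mul_apply]
  push_cast
  linear_combination (dt (conj l u) t x - (2 * ε * (l t * beta x) - 1) * dx (conj l u) t x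
    - ε * (l t * beta x) * conj l u t x) * hP

end Conjugation

section WeightBounds

lemma beta_bounds {x : ℝ} (hx : x ∈ Icc (-1 : ℝ) 0) : 27 / 10 ≤ beta x ∧ beta x ≤ 74 / 10 := by
  have h1 := Real.exp_one_gt_d9
  have h2 := Real.exp_one_lt_d9
  have e2 : Real.exp 2 = Real.exp 1 ^ 2 := by rw [← Real.exp_nat_mul]; norm_num
  constructor
  · have : Real.exp 1 ≤ beta x := Real.exp_le_exp.mpr (by linarith [hx.1])
    linarith
  · have : beta x ≤ Real.exp 2 := Real.exp_le_exp.mpr (by linarith [hx.2])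
    nlinarith

lemma eta_bounds {x : ℝ} (hx : x ∈ Icc (-1 : ℝ) 0) : 12 ≤ eta x ∧ eta x ≤ 18 := by
  have h1 := Real.exp_one_gt_d9
  have h2 := Real.exp_one_lt_d9
  have e2 : Real.exp 2 = Real.exp 1 ^ 2 := by rw [← Real.exp_nat_mul]; norm_num
  have e3 : Real.exp 3 = Real.exp 1 ^ 3 := by rw [← Real.exp_nat_mul]; norm_num
  have h3 : Real.exp 1 ≤ beta x := Real.exp_le_exp.mpr (by linarith [hx.1])
  have h4 : beta x ≤ Real.exp 2 := Real.exp_le_exp.mpr (by linarith [hx.2])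
  have h5 : (2.7182818283 : ℝ) ^ 3 ≤ Real.exp 1 ^ 3 := by gcongr
  have h6 : Real.exp 1 ^ 3 ≤ (2.7182818286 : ℝ) ^ 3 := by gcongr
  have h7 : Real.exp 1 ^ 2 ≤ (2.7182818286 : ℝ) ^ 2 := by gcongr
  unfold eta
  constructor <;> norm_num at * <;> linarith

lemma eta_anti {x : ℝ} (hx : x ∈ Icc (-1 : ℝ) 0) : eta 0 ≤ eta x ∧ eta x ≤ eta (-1) := by
  have h3 : beta (-1) ≤ beta x := Real.exp_le_exp.mpr (by linarith [hx.1])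
  have h4 : beta x ≤ beta 0 := Real.exp_le_exp.mpr (by linarith [hx.2])
  unfold eta
  constructor <;> linarith

/-- The gap `2 η(0) - η(-1)` is positive, hence the observation weight decays. -/
lemma eta_gap : 1 ≤ 2 * eta 0 - eta (-1) := by
  have h1 := (eta_bounds (x := 0) (by norm_num)).1
  have h2 := (eta_bounds (x := -1) (by norm_num)).2
  linarith

end WeightBounds

section Scaling

/-- Smallness of the data relative to the weight value `l` at a fixed time; `d₁`, `d₂` stand for
the first two derivatives of the weight. -/
structure Small (κ ε a l d₁ d₂ : ℝ) : Prop where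
  κ_pos : 0 < κ
  ε_pos : 0 < ε
  ε_lt : ε < 1
  l_pos : 0 < l
  one_le : 1 ≤ κ * (ε * l)
  d₁_le : |d₁| ≤ κ * (ε * l ^ 2)
  d₂_le : |d₂| ≤ κ * (ε ^ 2 * l ^ 3)
  a_nonneg : 0 ≤ a
  a_le : a ≤ κ * (ε * l ^ 2)

variable {κ ε a l d₁ d₂ : ℝ}

lemma Small.exists_scaled (h : Small κ ε a l d₁ d₂) : ∃ δ r₁ r₂ r₃ : ℝ, 0 < δ ∧ δ ≤ κ ∧
    δ * (ε * l) = 1 ∧ |r₁| ≤ κ ∧ 0 ≤ r₂ ∧ r₂ ≤ κ ∧ |r₃| ≤ κ ∧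
    d₁ = r₁ * (ε * l ^ 2) ∧ a = r₂ * (ε * l ^ 2) ∧ d₂ = r₃ * (ε ^ 2 * l ^ 3) := by
  have hε := h.ε_pos
  have hl := h.l_pos
  have h1 : 0 < ε * l := by positivity
  have h2 : 0 < ε * l ^ 2 := by positivity
  have h3 : 0 < ε ^ 2 * l ^ 3 := by positivity
  refine ⟨1 / (ε * l), d₁ / (ε * l ^ 2), a / (ε * l ^ 2), d₂ / (ε ^ 2 * l ^ 3), by positivity,
    ?_, by field_simp, ?_, div_nonneg h.a_nonneg h2.le, ?_, ?_, by field_simp, by field_simp,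
    by field_simp⟩
  · rw [div_le_iff₀ h1]; exact h.one_le
  · rw [abs_div, abs_of_pos h2, div_le_iff₀ h2]; exact h.d₁_le
  · rw [div_le_iff₀ h2]; exact h.a_le
  · rw [abs_div, abs_of_pos h3, div_le_iff₀ h3]; exact h.d₂_le

lemma abs_mul_le_of_le {p q P Q : ℝ} (hp : |p| ≤ P) (hq : |q| ≤ Q) : |p * q| ≤ P * Q := by
  rw [abs_mul]
  exact mul_le_mul hp hq (abs_nonneg _) ((abs_nonneg _).trans hp)

lemma scaled_bulk_ge {δ r₁ r₃ ε β η : ℝ} (hδ : |δ| ≤ 1 / 10 ^ 6) (hr₁ : |r₁| ≤ 1 / 10 ^ 6)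
    (hr₃ : |r₃| ≤ 1 / 10 ^ 6) (hε : |ε| ≤ 1) (hβ : 27 / 10 ≤ β) (hβ' : β ≤ 74 / 10)
    (hη : |η| ≤ 18) :
    10 ≤ 1 / 2 * ((2 * β ^ 2 - δ * β - r₁ * β) * (2 * β - δ))
      - 1 / 2 * (2 * (r₁ * (β * β)) - r₁ * (δ * β) + r₃ * η)
      - 1 / 2 * ((ε * ε) * ((δ * δ) * β)) := by
  have hβa : |β| ≤ 74 / 10 := abs_le.mpr ⟨by linarith, hβ'⟩
  have h1 := abs_le.mp (abs_mul_le_of_le hδ hβa)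
  have h2 := abs_le.mp (abs_mul_le_of_le hr₁ hβa)
  have h3 := abs_le.mp (abs_mul_le_of_le hr₁ (abs_mul_le_of_le hβa hβa))
  have h4 := abs_le.mp (abs_mul_le_of_le hr₁ (abs_mul_le_of_le hδ hβa))
  have h5 := abs_le.mp (abs_mul_le_of_le hr₃ hη)
  have h6 := abs_le.mp (abs_mul_le_of_le (abs_mul_le_of_le hε hε)
    (abs_mul_le_of_le (abs_mul_le_of_le hδ hδ) hβa))
  have h7 := abs_le.mp hδ
  have h8 : 14 ≤ 2 * β ^ 2 - δ * β - r₁ * β := by nlinarith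
  have h9 : 5 ≤ 2 * β - δ := by linarith
  have h10 : 14 * 5 ≤ (2 * β ^ 2 - δ * β - r₁ * β) * (2 * β - δ) :=
    mul_le_mul h8 h9 (by norm_num) (by linarith)
  linarith

lemma Small.bulk_ge {l l₁ l₂ : ℝ → ℝ} {t x : ℝ} (h : Small (1 / 10 ^ 6) ε a (l t) (l₁ t) (l₂ t))
    (hx : x ∈ Icc (-1 : ℝ) 0) : 10 * (ε ^ 2 * l t ^ 3) ≤ bulk ε l l₁ l₂ t x := by
  obtain ⟨δ, r₁, r₂, r₃, hδ, hδ', hδl, hr₁, hr₂, hr₂', hr₃, e1, e2, e3⟩ := h.exists_scaled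
  obtain ⟨hβ, hβ'⟩ := beta_bounds hx
  obtain ⟨hη, hη'⟩ := eta_bounds hx
  have hε := h.ε_pos
  have hl := h.l_pos
  have key := scaled_bulk_ge (δ := δ) (r₁ := r₁) (r₃ := r₃) (ε := ε) (β := beta x) (η := eta x)
    (by rwa [abs_of_pos hδ]) hr₁ hr₃ (by rw [abs_of_pos hε]; exact h.ε_lt.le) hβ hβ'
    (abs_le.mpr ⟨by linarith, hη'⟩)
  have hδ2 : δ = 1 / (ε * l t) := by field_simp at hδl ⊢; linarith
  have e : bulk ε l l₁ l₂ t x = (ε ^ 2 * l t ^ 3) * (1 / 2 * ((2 * beta x ^ 2 - δ * beta x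
      - r₁ * beta x) * (2 * beta x - δ)) - 1 / 2 * (2 * (r₁ * (beta x * beta x))
      - r₁ * (δ * beta x) + r₃ * eta x) - 1 / 2 * ((ε * ε) * ((δ * δ) * beta x))) := by
    rw [bulk, e1, e3, hδ2]
    field_simp
  rw [e, mul_comm 10]
  exact mul_le_mul_of_nonneg_left key (by positivity)

lemma scaled_left_ge {δ r₁ r₂ ε β η f z : ℝ} (hδ0 : 0 < δ) (hδ : |δ| ≤ 1 / 10 ^ 6)
    (hr₁ : |r₁| ≤ 1 / 10 ^ 6) (hr₂ : |r₂| ≤ 1 / 10 ^ 6) (hε : |ε| ≤ 1) (hβ : 27 / 10 ≤ β)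
    (hβ' : β ≤ 74 / 10) (hη : |η| ≤ 18) :
    10 * f ^ 2 ≤ δ * z ^ 2 - (δ * β - r₁ * η) * (f * z) + 1 / 2 * (2 * β - δ) * z ^ 2
      + ε * (δ * β) * (f * z) - 1 / 2 * ((ε * ε) * ((δ * δ) * β)) * f ^ 2
      + 1 / 2 * ((2 * β - δ) * (β ^ 2 - δ * β + r₁ * η - r₂)) * f ^ 2 := by
  have hβa : |β| ≤ 74 / 10 := abs_le.mpr ⟨by linarith, hβ'⟩
  have h1 := abs_le.mp (abs_mul_le_of_le hδ hβa)
  have h2 := abs_le.mp (abs_mul_le_of_le hr₁ hη)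
  have h3 := abs_le.mp (abs_mul_le_of_le hε (abs_mul_le_of_le hδ hβa))
  have h6 := abs_le.mp (abs_mul_le_of_le (abs_mul_le_of_le hε hε)
    (abs_mul_le_of_le (abs_mul_le_of_le hδ hδ) hβa))
  have h7 := abs_le.mp hδ
  have h8 := abs_le.mp hr₂
  have h9 : 5 ≤ 2 * β - δ := by linarith
  have h10 : 7 ≤ β ^ 2 - δ * β + r₁ * η - r₂ := by nlinarith
  have h11 : 5 * 7 ≤ (2 * β - δ) * (β ^ 2 - δ * β + r₁ * η - r₂) :=
    mul_le_mul h9 h10 (by norm_num) (by linarith)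
  set c := -(δ * β - r₁ * η) + ε * (δ * β) with hc
  have hc1 : |c| ≤ 1 := abs_le.mpr ⟨by linarith, by linarith⟩
  have h12 : -(f ^ 2 + z ^ 2) ≤ c * (f * z) := by
    have := abs_le.mp (abs_mul_le_of_le hc1 (le_refl |f * z|))
    have h : |f * z| ≤ f ^ 2 + z ^ 2 := by
      rw [abs_mul]
      nlinarith [sq_nonneg (|f| - |z|), sq_abs f, sq_abs z, abs_nonneg f, abs_nonneg z]
    linarith [this.1]
  have hf := sq_nonneg f
  have hz := sq_nonneg z
  have h13 : 5 * 7 * f ^ 2 ≤ (2 * β - δ) * (β ^ 2 - δ * β + r₁ * η - r₂) * f ^ 2 :=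
    mul_le_mul_of_nonneg_right h11 hf
  have h14 : 5 * z ^ 2 ≤ (2 * β - δ) * z ^ 2 := mul_le_mul_of_nonneg_right h9 hz
  have h15 : (ε * ε) * ((δ * δ) * β) * f ^ 2 ≤ 1 * f ^ 2 :=
    mul_le_mul_of_nonneg_right (by linarith) hf
  have h16 : 0 ≤ δ * z ^ 2 := by positivity
  linarith

lemma scaled_right_ge {δ r₁ r₂ ε β η f y : ℝ} (hδ0 : 0 < δ) (hδ : |δ| ≤ 1 / 10 ^ 6)
    (hr₁ : |r₁| ≤ 1 / 10 ^ 6) (hr₂ : |r₂| ≤ 1 / 10 ^ 6) (hε : |ε| ≤ 1) (hβ : 27 / 10 ≤ β)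
    (hβ' : β ≤ 74 / 10) (hη : |η| ≤ 18) :
    -(10 ^ 4 * (y ^ 2 + f ^ 2)) ≤ (y + (β - δ) * f) * (δ * y - r₁ * η * f)
      - 1 / 2 * (2 * β - δ) * (y + (β - δ) * f) ^ 2
      - ε * (δ * β) * (f * (y + (β - δ) * f)) + 1 / 2 * ((ε * ε) * ((δ * δ) * β)) * f ^ 2
      - 1 / 2 * ((2 * β - δ) * (β ^ 2 - δ * β + r₁ * η - r₂)) * f ^ 2 := by
  have hβa : |β| ≤ 74 / 10 := abs_le.mpr ⟨by linarith, hβ'⟩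
  have h1 := abs_le.mp (abs_mul_le_of_le hδ hβa)
  have h2 := abs_le.mp (abs_mul_le_of_le hr₁ hη)
  have h3 := abs_mul_le_of_le hε (abs_mul_le_of_le hδ hβa)
  have h6 := abs_le.mp (abs_mul_le_of_le (abs_mul_le_of_le hε hε)
    (abs_mul_le_of_le (abs_mul_le_of_le hδ hδ) hβa))
  have h7 := abs_le.mp hδ
  have h8 := abs_le.mp hr₂
  have hf := sq_nonneg f
  have hy := sq_nonneg y
  set z := y + (β - δ) * f with hz
  have hb2 : (β - δ) ^ 2 ≤ 64 := by nlinarith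
  have hz2 : z ^ 2 ≤ 2 * y ^ 2 + 128 * f ^ 2 := by
    have : z ^ 2 ≤ 2 * y ^ 2 + 2 * ((β - δ) ^ 2 * f ^ 2) := by
      rw [hz]; nlinarith [sq_nonneg (y - (β - δ) * f)]
    have := mul_le_mul_of_nonneg_right hb2 hf
    linarith
  have hz0 := sq_nonneg z
  have prod : ∀ c p q : ℝ, |c| ≤ 1 → -(p ^ 2 + q ^ 2) ≤ c * (p * q) := fun c p q hc => by
    have := abs_le.mp (abs_mul_le_of_le hc (le_refl |p * q|))
    have h : |p * q| ≤ p ^ 2 + q ^ 2 := by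
      rw [abs_mul]
      nlinarith [sq_nonneg (|p| - |q|), sq_abs p, sq_abs q, abs_nonneg p, abs_nonneg q]
    linarith [this.1]
  have p1 := prod δ z y (hδ.trans (by norm_num))
  have p2 := prod (-(r₁ * η)) z f (by rw [abs_neg]; exact abs_le.mpr ⟨by linarith, by linarith⟩)
  have p3 := prod (-(ε * (δ * β))) f z (by rw [abs_neg]; linarith)
  have h9 : 2 * β - δ ≤ 16 := by linarith
  have h9' : 0 ≤ 2 * β - δ := by linarith
  have h10 : β ^ 2 - δ * β + r₁ * η - r₂ ≤ 60 := by nlinarith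
  have h11 : (2 * β - δ) * (β ^ 2 - δ * β + r₁ * η - r₂) ≤ 16 * 60 :=
    (mul_le_mul_of_nonneg_left h10 h9').trans (mul_le_mul_of_nonneg_right h9 (by norm_num))
  have h13 := mul_le_mul_of_nonneg_right h11 hf
  have h14 := mul_le_mul_of_nonneg_right h9 hz0
  have h15 : 0 ≤ (ε * ε) * ((δ * δ) * β) * f ^ 2 :=
    mul_nonneg (mul_nonneg (mul_self_nonneg _) (mul_nonneg (mul_self_nonneg _) (by linarith))) hf
  linarith

end Scaling

section Boundary

variable {U : Set ℝ} {ε a : ℝ} {u : ℝ → ℝ → ℝ} {l l₁ l₂ : ℝ → ℝ} {t : ℝ}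

lemma Sol.carlFlux_left (hU : IsOpen U) (h : Sol U ε a u) (hl : TimeWeight U l l₁ l₂) (ht : t ∈ U)
    (hs : Small (1 / 10 ^ 6) ε a (l t) (l₁ t) (l₂ t)) :
    10 * (ε ^ 2 * l t ^ 3) * conj l u t (-1) ^ 2 ≤ -carlFlux ε a l l₁ u t (-1) := by
  obtain ⟨δ, r₁, r₂, r₃, hδ, hδ', hδl, hr₁, hr₂, hr₂', hr₃, e1, e2, e3⟩ := hs.exists_scaled
  have hx : (-1 : ℝ) ∈ Icc (-1 : ℝ) 0 := by norm_num
  obtain ⟨hβ, hβ'⟩ := beta_bounds hx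
  obtain ⟨hη, hη'⟩ := eta_bounds hx
  have hε := hs.ε_pos
  have hl' := hs.l_pos
  have key := scaled_left_ge (δ := δ) (r₁ := r₁) (r₂ := r₂) (ε := ε) (β := beta (-1))
    (η := eta (-1)) (f := conj l u t (-1)) (z := dx (conj l u) t (-1) / l t) hδ
    (by rwa [abs_of_pos hδ]) hr₁ (by rwa [abs_of_nonneg hr₂])
    (by rw [abs_of_pos hε]; exact hs.ε_lt.le) hβ hβ' (abs_le.mpr ⟨by linarith, hη'⟩)
  have hδ2 : δ = 1 / (ε * l t) := by field_simp at hδl ⊢; linarith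
  have hψt : dt (conj l u) t (-1) = -dx (conj l u) t (-1)
      + (l t * beta (-1) - l₁ t * eta (-1)) * conj l u t (-1) := by
    rw [hl.dt_conj hU h.sm ht, TimeWeight.dx_conj hU h.sm ht, conj]
    linear_combination Real.exp (-(l t * eta (-1))) * h.left t ht
  have := mul_le_mul_of_nonneg_left key (show 0 ≤ ε ^ 2 * l t ^ 3 by positivity)
  refine le_trans (le_of_eq (by ring)) (this.trans (le_of_eq ?_))
  rw [carlFlux, hψt, potential, e1, e2, hδ2]
  field_simp
  ring

lemma Sol.carlFlux_right (hU : IsOpen U) (h : Sol U ε a u) (hl : TimeWeight U l l₁ l₂)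
    (ht : t ∈ U) (hs : Small (1 / 10 ^ 6) ε a (l t) (l₁ t) (l₂ t)) :
    -(10 ^ 4 * ε ^ 2 * Real.exp (-2 * (l t * eta 0))
      * (l t * dt u t 0 ^ 2 + l t ^ 3 * u t 0 ^ 2)) ≤ carlFlux ε a l l₁ u t 0 := by
  obtain ⟨δ, r₁, r₂, r₃, hδ, hδ', hδl, hr₁, hr₂, hr₂', hr₃, e1, e2, e3⟩ := hs.exists_scaled
  have hx : (0 : ℝ) ∈ Icc (-1 : ℝ) 0 := by norm_num
  obtain ⟨hβ, hβ'⟩ := beta_bounds hx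
  obtain ⟨hη, hη'⟩ := eta_bounds hx
  have hε := hs.ε_pos
  have hl' := hs.l_pos
  have key := scaled_right_ge (δ := δ) (r₁ := r₁) (r₂ := r₂) (ε := ε) (β := beta 0)
    (η := eta 0) (f := u t 0) (y := dt u t 0 / l t) hδ
    (by rwa [abs_of_pos hδ]) hr₁ (by rwa [abs_of_nonneg hr₂])
    (by rw [abs_of_pos hε]; exact hs.ε_lt.le) hβ hβ' (abs_le.mpr ⟨by linarith, hη'⟩)
  have hδ2 : δ = 1 / (ε * l t) := by field_simp at hδl ⊢; linarith
  have hux : dx u t 0 = dt u t 0 - u t 0 / ε := by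
    have := h.right t ht
    field_simp
    linarith
  have hE : Real.exp (-2 * (l t * eta 0)) = Real.exp (-(l t * eta 0)) ^ 2 := by
    rw [← Real.exp_nat_mul]; push_cast; ring_nf
  have := mul_le_mul_of_nonneg_left key
    (show 0 ≤ ε ^ 2 * l t ^ 3 * Real.exp (-(l t * eta 0)) ^ 2 by positivity)
  refine le_trans (le_of_eq ?_) (this.trans (le_of_eq ?_))
  · rw [hE]
    field_simp
  · rw [carlFlux, hl.dt_conj hU h.sm ht, TimeWeight.dx_conj hU h.sm ht, conj, hux, potential, e1,
      e2, hδ2]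
    field_simp
    ring

/-- Differential form of the Carleman inequality. -/
lemma Sol.carleman_deriv_ge (hU : IsOpen U) (h : Sol U ε a u) (hl : TimeWeight U l l₁ l₂)
    (ht : t ∈ U) (hs : Small (1 / 10 ^ 6) ε a (l t) (l₁ t) (l₂ t)) :
    ∃ D, HasDerivAt (fun t => -(∫ x in (-1 : ℝ)..0, carlDensity ε a l l₁ u t x) / ε ^ 2) D t ∧
      10 * l t ^ 3 * nsq (conj l u) t + 10 * l t ^ 3 * conj l u t (-1) ^ 2
        - 10 ^ 4 * Real.exp (-2 * (l t * eta 0))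
          * (l t * dt u t 0 ^ 2 + l t ^ 3 * u t 0 ^ 2) ≤ D := by
  refine ⟨_, ((h.hasDerivAt_carleman hU hl ht).neg.div_const (ε ^ 2)), ?_⟩
  have hε := hs.ε_pos
  have hl' := hs.l_pos
  rw [le_div_iff₀ (by positivity)]
  have h1 := h.carlFlux_left hU hl ht hs
  have h2 := h.carlFlux_right hU hl ht hs
  have hψ := hl.sm_conj h.sm
  have h3 : 10 * (ε ^ 2 * l t ^ 3) * nsq (conj l u) t
      ≤ -∫ x in (-1 : ℝ)..0, -(2 * ε ^ 2 * (l t * beta x) * dx (conj l u) t x ^ 2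
          + bulk ε l l₁ l₂ t x * conj l u t x ^ 2
          + (dt (conj l u) t x - (2 * ε * (l t * beta x) - 1) * dx (conj l u) t x
            - ε * (l t * beta x) * conj l u t x) ^ 2) := by
    rw [← intervalIntegral.integral_neg, nsq, ← intervalIntegral.integral_const_mul]
    have c1 := hψ.continuous_x ht
    have c2 := (hψ.dx hU).continuous_x ht
    have c3 := (hψ.dt hU).continuous_x ht
    have c4 : Continuous beta := contDiff_beta.continuous
    have c5 : Continuous eta := contDiff_eta.continuous
    refine intervalIntegral.integral_mono_on (by norm_num)
      (by apply Continuous.intervalIntegrable; fun_prop)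
      (by apply Continuous.intervalIntegrable; unfold bulk; fun_prop) fun x hx => ?_
    have h4 := mul_le_mul_of_nonneg_right (hs.bulk_ge hx) (sq_nonneg (conj l u t x))
    have h5 : 0 ≤ 2 * ε ^ 2 * (l t * beta x) * dx (conj l u) t x ^ 2 := by
      have : 0 < beta x := Real.exp_pos _
      positivity
    nlinarith [sq_nonneg (dt (conj l u) t x - (2 * ε * (l t * beta x) - 1) * dx (conj l u) t x
            - ε * (l t * beta x) * conj l u t x)]
  linarith

end Boundary

section Chain

variable {U : Set ℝ} {ε a : ℝ} {u : ℝ → ℝ → ℝ} {l l₁ l₂ : ℝ → ℝ} {t : ℝ}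

/-- The temporal weight `λᵏ exp (-2 c λ)`. -/
def powExp (l : ℝ → ℝ) (c : ℝ) (k : ℤ) (t : ℝ) : ℝ := l t ^ k * Real.exp (-2 * (l t * c))

lemma TimeWeight.hasDerivAt_powExp (hl : TimeWeight U l l₁ l₂) (ht : t ∈ U) (h0 : l t ≠ 0)
    (c : ℝ) (k : ℤ) :
    HasDerivAt (powExp l c k) (powExp l c k t * (l₁ t * (k / l t - 2 * c))) t := by
  have h1 := (hasDerivAt_zpow k (l t) (Or.inl h0)).comp t (hl.hasDeriv t ht)
  have h2 := (((hl.hasDeriv t ht).mul_const c).const_mul (-2)).exp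
  refine HasDerivAt.congr_deriv (h1.mul h2) ?_
  simp only [powExp, zpow_sub_one₀ h0, Function.comp]
  field_simp
  ring

lemma Small.one_le_l {ε a l d₁ d₂ : ℝ} (h : Small (1 / 10 ^ 6) ε a l d₁ d₂) : 1 ≤ l := by
  nlinarith [h.one_le, h.ε_lt, h.l_pos]

lemma Small.rate_le {ε a l d₁ d₂ : ℝ} (h : Small (1 / 10 ^ 6) ε a l d₁ d₂) {c k : ℝ} (hc : 0 ≤ c)
    (hc' : c ≤ 18) (hk : |k| ≤ 5) : |d₁ * (k / l - 2 * c)| ≤ 1 / 10 ^ 4 * (ε * l ^ 2) := by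
  have hl := h.l_pos
  have h1 : |k / l| ≤ 5 := by
    rw [abs_div, abs_of_pos hl, div_le_iff₀ hl]
    linarith [h.one_le_l]
  have h2 := abs_le.mp h1
  have h3 : |k / l - 2 * c| ≤ 41 := abs_le.mpr ⟨by linarith, by linarith⟩
  have h4 := abs_mul_le_of_le h.d₁_le h3
  have h5 : 0 ≤ ε * l ^ 2 := by have := h.ε_pos; positivity
  linarith

lemma Sol.weighted_energyZero (hU : IsOpen U) (h : Sol U ε a u) (hl : TimeWeight U l l₁ l₂)
    (ht : t ∈ U) (hs : Small (1 / 10 ^ 6) ε a (l t) (l₁ t) (l₂ t)) {c : ℝ} (hc : 0 ≤ c)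
    (hc' : c ≤ 18) {k : ℤ} (hk : |(k : ℝ)| ≤ 5) :
    ∃ D, HasDerivAt (fun t => powExp l c k t * energyZero ε u t) D t ∧
      powExp l c k t * (ε * nsq (dx u) t) - 1 / 10 ^ 4 * (ε * l t ^ 2)
        * (powExp l c k t * ((nsq u t + ε * (u t 0 ^ 2 + u t (-1) ^ 2)) / 2)) ≤ D := by
  refine ⟨_, (hl.hasDerivAt_powExp ht hs.l_pos.ne' c k).mul (h.hasDerivAt_energyZero hU ht), ?_⟩
  have hr := abs_le.mp (hs.rate_le hc hc' hk)
  have hg : 0 < powExp l c k t := mul_pos (zpow_pos hs.l_pos _) (Real.exp_pos _)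
  have hε := hs.ε_pos
  have n0 := nsq_nonneg u t
  have ha := hs.a_nonneg
  have hA : 0 ≤ energyZero ε u t := by unfold energyZero; positivity
  have h1 := mul_le_mul_of_nonneg_right hr.1 (mul_nonneg hg.le hA)
  have h2 : 0 ≤ powExp l c k t * (a * nsq u t + u t 0 ^ 2 / 2 + u t (-1) ^ 2 / 2) := by positivity
  unfold energyZero at *
  linarith

lemma Sol.weighted_energyOne (hU : IsOpen U) (h : Sol U ε a u) (hl : TimeWeight U l l₁ l₂)
    (ht : t ∈ U) (hs : Small (1 / 10 ^ 6) ε a (l t) (l₁ t) (l₂ t)) {c : ℝ} (hc : 0 ≤ c)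
    (hc' : c ≤ 18) {k : ℤ} (hk : |(k : ℝ)| ≤ 5) :
    ∃ D, HasDerivAt (fun t => powExp l c k t * energyOne ε a u t) D t ∧
      powExp l c k t * (nsq (dt u) t / 2 - nsq (dx u) t / 2
          + ε * (dt u t 0 ^ 2 + dt u t (-1) ^ 2))
        - 1 / 10 ^ 4 * (ε * l t ^ 2) * (powExp l c k t
          * ((ε * nsq (dx u) t + a * nsq u t + u t 0 ^ 2) / 2)) ≤ D := by
  refine ⟨_, (hl.hasDerivAt_powExp ht hs.l_pos.ne' c k).mul (h.hasDerivAt_energyOne hU ht), ?_⟩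
  have hr := abs_le.mp (hs.rate_le hc hc' hk)
  have hg : 0 < powExp l c k t := mul_pos (zpow_pos hs.l_pos _) (Real.exp_pos _)
  have hε := hs.ε_pos
  have n0 := nsq_nonneg u t
  have n1 := nsq_nonneg (dx u) t
  have ha := hs.a_nonneg
  have hA : 0 ≤ energyOne ε a u t := by unfold energyOne; positivity
  have h1 := mul_le_mul_of_nonneg_right hr.1 (mul_nonneg hg.le hA)
  have h2 := mul_le_mul_of_nonneg_left (h.energyOne_deriv_ge hU ht) hg.le
  unfold energyOne at *
  linarith

set_option maxHeartbeats 1000000 in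
/-- Algebraic combination of the four weighted energy inequalities. -/
lemma Small.energy_chain {ε a l d₁ d₂ : ℝ} (h : Small (1 / 10 ^ 6) ε a l d₁ d₂)
    {E J₀ J₁ J₂ J₃ J₄ b₀ b₁ b₂ c₀ c₁ c₂ D₁ D₂ D₃ D₄ : ℝ} (hE : 0 < E) (hJ₀ : 0 ≤ J₀)
    (hJ₁ : 0 ≤ J₁) (hJ₂ : 0 ≤ J₂) (hJ₃ : 0 ≤ J₃) (hJ₄ : 0 ≤ J₄) (hb₀ : 0 ≤ b₀) (hb₁ : 0 ≤ b₁)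
    (hc₀ : 0 ≤ c₀) (hc₁ : 0 ≤ c₁) (hc₂ : 0 ≤ c₂)
    (h₁ : l ^ (1 : ℤ) * E * (ε * J₁)
      - 1 / 10 ^ 4 * (ε * l ^ 2) * (l ^ (1 : ℤ) * E * ((J₀ + ε * (b₀ + c₀)) / 2)) ≤ D₁)
    (h₂ : l ^ (-1 : ℤ) * E * (J₂ / 2 - J₁ / 2 + ε * (b₁ + c₁))
      - 1 / 10 ^ 4 * (ε * l ^ 2) * (l ^ (-1 : ℤ) * E * ((ε * J₁ + a * J₀ + b₀) / 2)) ≤ D₂)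
    (h₃ : l ^ (-3 : ℤ) * E * (ε * J₃)
      - 1 / 10 ^ 4 * (ε * l ^ 2) * (l ^ (-3 : ℤ) * E * ((J₂ + ε * (b₁ + c₁)) / 2)) ≤ D₃)
    (h₄ : l ^ (-5 : ℤ) * E * (J₄ / 2 - J₃ / 2 + ε * (b₂ + c₂))
      - 1 / 10 ^ 4 * (ε * l ^ 2) * (l ^ (-5 : ℤ) * E * ((ε * J₃ + a * J₂ + b₁) / 2)) ≤ D₄) :
    E * b₂ / (l ^ 5 * ε ^ 3) - l ^ 3 * E * (J₀ + b₀ + c₀)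
      ≤ D₁ / ε + D₂ / ε ^ 2 + D₃ / ε ^ 3 + D₄ / ε ^ 4 := by
  obtain ⟨δ, r₁, r₂, r₃, hδ, hδ', hδl, -, hr₂, hr₂', -, -, ha, -⟩ := h.exists_scaled
  have hε := h.ε_pos
  have hε1 := h.ε_lt
  have hl := h.l_pos
  have hδ2 : δ = 1 / (ε * l) := by field_simp at hδl ⊢; linarith
  have z1 : l ^ (-1 : ℤ) = 1 / l := by simp
  have z3 : l ^ (-3 : ℤ) = 1 / l ^ 3 := by rw [zpow_neg]; norm_cast; simp
  have z5 : l ^ (-5 : ℤ) = 1 / l ^ 5 := by rw [zpow_neg]; norm_cast; simp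
  rw [zpow_one] at h₁
  rw [z1] at h₂
  rw [z3] at h₃
  rw [z5] at h₄
  obtain ⟨x₀, hx₀⟩ : ∃ x, x = l ^ 3 * E * J₀ := ⟨_, rfl⟩
  obtain ⟨x₁, hx₁⟩ : ∃ x, x = l * E * J₁ := ⟨_, rfl⟩
  obtain ⟨x₂, hx₂⟩ : ∃ x, x = E * J₂ / (l * ε ^ 2) := ⟨_, rfl⟩
  obtain ⟨x₃, hx₃⟩ : ∃ x, x = E * J₃ / (l ^ 3 * ε ^ 2) := ⟨_, rfl⟩
  obtain ⟨β₀, hβ₀⟩ : ∃ x, x = l ^ 3 * E * b₀ := ⟨_, rfl⟩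
  obtain ⟨γ₀, hγ₀⟩ : ∃ x, x = l ^ 3 * E * c₀ := ⟨_, rfl⟩
  obtain ⟨β₁, hβ₁⟩ : ∃ x, x = E * b₁ / (l * ε) := ⟨_, rfl⟩
  obtain ⟨γ₁, hγ₁⟩ : ∃ x, x = E * c₁ / (l * ε) := ⟨_, rfl⟩
  have px₀ : 0 ≤ x₀ := by rw [hx₀]; positivity
  have px₁ : 0 ≤ x₁ := by rw [hx₁]; positivity
  have px₂ : 0 ≤ x₂ := by rw [hx₂]; positivity
  have px₃ : 0 ≤ x₃ := by rw [hx₃]; positivity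
  have pβ₀ : 0 ≤ β₀ := by rw [hβ₀]; positivity
  have pγ₀ : 0 ≤ γ₀ := by rw [hγ₀]; positivity
  have pβ₁ : 0 ≤ β₁ := by rw [hβ₁]; positivity
  have pγ₁ : 0 ≤ γ₁ := by rw [hγ₁]; positivity
  have e₁ : x₁ - 1 / 10 ^ 4 / 2 * (x₀ + ε * (β₀ + γ₀)) ≤ D₁ / ε := by
    rw [le_div_iff₀ hε]
    refine le_trans (le_of_eq ?_) h₁
    rw [hx₀, hx₁, hβ₀, hγ₀]
    ring
  have e₂ : x₂ / 2 - δ ^ 2 / 2 * x₁ + β₁ + γ₁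
      - 1 / 10 ^ 4 / 2 * (x₁ + r₂ * x₀ + ε * δ ^ 2 * β₀) ≤ D₂ / ε ^ 2 := by
    rw [le_div_iff₀ (by positivity)]
    refine le_trans (le_of_eq ?_) h₂
    rw [hx₀, hx₁, hx₂, hβ₀, hβ₁, hγ₁, hδ2, ha]
    field_simp
    ring
  have e₃ : x₃ - 1 / 10 ^ 4 / 2 * (x₂ + β₁ + γ₁) ≤ D₃ / ε ^ 3 := by
    rw [le_div_iff₀ (by positivity)]
    refine le_trans (le_of_eq ?_) h₃
    rw [hx₂, hx₃, hβ₁, hγ₁]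
    field_simp
    ring
  have e₄ : E * b₂ / (l ^ 5 * ε ^ 3) - δ ^ 2 / 2 * x₃
      - 1 / 10 ^ 4 / 2 * (x₃ + r₂ * x₂ + δ ^ 2 * β₁) ≤ D₄ / ε ^ 4 := by
    rw [le_div_iff₀ (by positivity)]
    have : 0 ≤ 1 / l ^ 5 * E * (J₄ / 2 + ε * c₂) := by positivity
    refine le_trans (le_trans (le_of_eq ?_) (sub_le_self _ this)) h₄
    rw [hx₂, hx₃, hβ₁, hδ2, ha]
    field_simp
    ring
  have s1 : δ ^ 2 ≤ 1 / 10 ^ 4 :=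
    (pow_le_pow_left₀ hδ.le hδ' 2).trans (by norm_num)
  have s2 : ε * δ ^ 2 ≤ 1 * 1 :=
    mul_le_mul hε1.le (s1.trans (by norm_num)) (sq_nonneg δ) zero_le_one
  have m1 := mul_le_mul_of_nonneg_right s1 px₁
  have m2 := mul_le_mul_of_nonneg_right s1 px₃
  have m3 := mul_le_mul_of_nonneg_right s1 pβ₁
  have m4 := mul_le_mul_of_nonneg_right hr₂' px₀
  have m5 := mul_le_mul_of_nonneg_right hr₂' px₂
  have m6 : ε * δ ^ 2 * β₀ ≤ 1 * β₀ := mul_le_mul_of_nonneg_right (by linarith) pβ₀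
  have m7 : ε * (β₀ + γ₀) ≤ 1 * (β₀ + γ₀) := mul_le_mul_of_nonneg_right hε1.le (by positivity)
  have : l ^ 3 * E * (J₀ + b₀ + c₀) = x₀ + β₀ + γ₀ := by rw [hx₀, hβ₀, hγ₀]; ring
  linarith

/-- The functional trading `∂ₜ u(·,0)` against `u(·,0)` and `∂ₜ² u(·,0)`. -/
def tradeFun (l l₁ : ℝ → ℝ) (c : ℝ) (v v₁ : ℝ → ℝ) (t : ℝ) : ℝ :=
  Real.exp (-2 * (l t * c)) * (l t * (v t * v₁ t)
    - 1 / 2 * (l₁ t * (1 - 2 * c * l t) * v t ^ 2))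

lemma TimeWeight.hasDerivAt_tradeFun (hl : TimeWeight U l l₁ l₂) (ht : t ∈ U)
    (hs : Small (1 / 10 ^ 6) ε a (l t) (l₁ t) (l₂ t)) {c : ℝ} (hc : 0 ≤ c) (hc' : c ≤ 18)
    {v v₁ v₂ : ℝ → ℝ} (hv : HasDerivAt v (v₁ t) t) (hv₁ : HasDerivAt v₁ (v₂ t) t) :
    ∃ D, HasDerivAt (tradeFun l l₁ c v v₁) D t ∧
      Real.exp (-2 * (l t * c)) * (l t * v₁ t ^ 2 + l t * (v t * v₂ t) - 750 * l t ^ 7 * v t ^ 2)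
        ≤ D := by
  have hL := hl.hasDeriv t ht
  have hE := ((hL.mul_const c).const_mul (-2)).exp
  have h1 := hL.mul (hv.mul hv₁)
  have h2 := (((hl.hasDeriv₁ t ht).mul ((hL.const_mul (2 * c)).const_sub 1)).mul
    (hv.pow 2)).const_mul (1 / 2)
  refine ⟨_, hE.mul (h1.sub h2), ?_⟩
  have hl1 := hs.one_le_l
  have hε := hs.ε_pos
  have hε1 := hs.ε_lt
  have b2 : |l₂ t| ≤ l t ^ 3 := hs.d₂_le.trans (by
    have : ε ^ 2 * l t ^ 3 ≤ 1 * l t ^ 3 :=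
      mul_le_mul_of_nonneg_right (by nlinarith) (by positivity)
    have : 0 ≤ ε ^ 2 * l t ^ 3 := by positivity
    linarith)
  have b1 : |l₁ t| ≤ l t ^ 2 := hs.d₁_le.trans (by
    have : ε * l t ^ 2 ≤ 1 * l t ^ 2 := mul_le_mul_of_nonneg_right hε1.le (by positivity)
    have : 0 ≤ ε * l t ^ 2 := by positivity
    linarith)
  have hcl : c * l t ≤ 18 * l t := mul_le_mul_of_nonneg_right hc' (by linarith)
  have hcl0 : 0 ≤ c * l t := mul_nonneg hc (by linarith)
  have b3 : |1 - 2 * c * l t| ≤ 37 * l t := abs_le.mpr ⟨by linarith, by linarith⟩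
  have b4 : |2 * c * (2 - 2 * c * l t)| ≤ 36 * (38 * l t) :=
    abs_mul_le_of_le (abs_le.mpr ⟨by linarith, by linarith⟩)
      (abs_le.mpr ⟨by linarith, by linarith⟩)
  have b5 := (abs_le.mp (abs_mul_le_of_le b2 b3)).2
  have b6 := (abs_le.mp (abs_mul_le_of_le (abs_mul_le_of_le b1 b1) b4)).1
  have p45 : l t ^ 3 * (37 * l t) ≤ 37 * l t ^ 7 := by
    have : l t ^ 4 ≤ l t ^ 7 := pow_le_pow_right₀ hl1 (by norm_num)
    nlinarith
  have p57 : l t ^ 2 * l t ^ 2 * (36 * (38 * l t)) ≤ 1368 * l t ^ 7 := by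
    have : l t ^ 5 ≤ l t ^ 7 := pow_le_pow_right₀ hl1 (by norm_num)
    nlinarith
  have b7 : l₂ t * (1 - 2 * c * l t) - l₁ t * l₁ t * (2 * c * (2 - 2 * c * l t))
      ≤ 1500 * l t ^ 7 := by
    have : 0 ≤ l t ^ 7 := by positivity
    linarith
  have b8 := mul_le_mul_of_nonneg_right b7
    (show 0 ≤ Real.exp (-2 * (l t * c)) * v t ^ 2 by positivity)
  simp only [Pi.pow_apply, Pi.mul_apply]
  push_cast
  linarith

end Chain

section Lyapunov

variable {U : Set ℝ} {ε a : ℝ} {u : ℝ → ℝ → ℝ} {l l₁ l₂ : ℝ → ℝ} {t : ℝ}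

/-- The functional whose derivative controls the weighted norms of a solution. -/
def lyapunov (ε a : ℝ) (l l₁ : ℝ → ℝ) (u : ℝ → ℝ → ℝ) (t : ℝ) : ℝ :=
  -(∫ x in (-1 : ℝ)..0, carlDensity ε a l l₁ u t x) / ε ^ 2
    + powExp l (eta (-1)) 1 t * energyZero ε u t / ε
    + powExp l (eta (-1)) (-1) t * energyOne ε a u t / ε ^ 2
    + powExp l (eta (-1)) (-3) t * energyZero ε (dt u) t / ε ^ 3
    + powExp l (eta (-1)) (-5) t * energyOne ε a (dt u) t / ε ^ 4
    + 2 * 10 ^ 4 * tradeFun l l₁ (eta 0) (fun t => u t 0) (fun t => dt u t 0) t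

lemma conj_sq (l : ℝ → ℝ) (u : ℝ → ℝ → ℝ) (t x : ℝ) :
    conj l u t x ^ 2 = Real.exp (-2 * (l t * eta x)) * u t x ^ 2 := by
  rw [conj, mul_pow, ← Real.exp_nat_mul]
  congr 2
  push_cast
  ring

lemma exp_mul_nsq_le (hu : Continuous (u t)) (hl : 0 ≤ l t) :
    Real.exp (-2 * (l t * eta (-1))) * nsq u t ≤ nsq (conj l u) t := by
  unfold nsq
  rw [← intervalIntegral.integral_const_mul]
  refine intervalIntegral.integral_mono_on (by norm_num) ?_ ?_ fun x hx => ?_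
  · exact (by fun_prop : Continuous _).intervalIntegrable _ _
  · have : Continuous fun x => conj l u t x ^ 2 := by
      unfold conj
      have := contDiff_eta.continuous
      fun_prop
    exact this.intervalIntegrable _ _
  · rw [conj_sq]
    have := mul_le_mul_of_nonneg_left (eta_anti hx).2 hl
    exact mul_le_mul_of_nonneg_right (Real.exp_le_exp.mpr (by linarith)) (sq_nonneg _)

lemma trade_absorb {l ε E N M v v₂ : ℝ} (hl : 0 < l) (hε : 0 < ε) (hε1 : ε < 1) (hE : 0 < E)
    (hM : 0 ≤ M) (hN : N ^ 2 = M * E) :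
    -(E * v₂ ^ 2 / (l ^ 5 * ε ^ 3)) - 10 ^ 8 * (l ^ 7 * M * v ^ 2)
      ≤ 2 * 10 ^ 4 * (N * (l * (v * v₂))) := by
  have h0 : 0 ≤ E / (l ^ 5 * ε ^ 3) * (v₂ + 10 ^ 4 * (N * l ^ 6 * ε ^ 3 / E) * v) ^ 2 := by
    positivity
  have h1 : E / (l ^ 5 * ε ^ 3) * (v₂ + 10 ^ 4 * (N * l ^ 6 * ε ^ 3 / E) * v) ^ 2
      = E * v₂ ^ 2 / (l ^ 5 * ε ^ 3) + 2 * 10 ^ 4 * (N * (l * (v * v₂)))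
        + 10 ^ 8 * (l ^ 7 * ε ^ 3 * (N ^ 2 / E) * v ^ 2) := by
    field_simp
    ring
  have h2 : N ^ 2 / E = M := by rw [hN]; field_simp
  have h3 : l ^ 7 * ε ^ 3 * M * v ^ 2 ≤ l ^ 7 * 1 * M * v ^ 2 := by
    gcongr
    exact pow_le_one₀ hε.le hε1.le
  rw [h1, h2] at h0
  linarith

theorem Sol.lyapunov_deriv_ge (hU : IsOpen U) (h : Sol U ε a u) (hl : TimeWeight U l l₁ l₂)
    (ht : t ∈ U) (hs : Small (1 / 10 ^ 6) ε a (l t) (l₁ t) (l₂ t)) :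
    ∃ D, HasDerivAt (lyapunov ε a l l₁ u) D t ∧
      9 * l t ^ 3 * (nsq (conj l u) t + conj l u t (-1) ^ 2)
        - 10 ^ 9 * (l t ^ 7 * Real.exp (-4 * (l t * eta 0) + 2 * (l t * eta (-1))) * u t 0 ^ 2)
        ≤ D := by
  have h' := h.deriv_time hU
  obtain ⟨η₀, η₀'⟩ := eta_bounds (x := 0) (by norm_num)
  obtain ⟨η₁, η₁'⟩ := eta_bounds (x := -1) (by norm_num)
  have hη := (eta_anti (x := -1) (by norm_num)).1
  obtain ⟨D₀, hD₀, i₀⟩ := h.carleman_deriv_ge hU hl ht hs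
  obtain ⟨D₁, hD₁, i₁⟩ := h.weighted_energyZero hU hl ht hs (c := eta (-1)) (k := 1)
    (by linarith) η₁' (by norm_num)
  obtain ⟨D₂, hD₂, i₂⟩ := h.weighted_energyOne hU hl ht hs (c := eta (-1)) (k := -1)
    (by linarith) η₁' (by norm_num)
  obtain ⟨D₃, hD₃, i₃⟩ := h'.weighted_energyZero hU hl ht hs (c := eta (-1)) (k := -3)
    (by linarith) η₁' (by norm_num)
  obtain ⟨D₄, hD₄, i₄⟩ := h'.weighted_energyOne hU hl ht hs (c := eta (-1)) (k := -5)
    (by linarith) η₁' (by norm_num)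
  obtain ⟨D₅, hD₅, i₅⟩ := hl.hasDerivAt_tradeFun ht hs (c := eta 0) (by linarith) η₀'
    (v := fun t => u t 0) (v₁ := fun t => dt u t 0) (v₂ := fun t => dt (dt u) t 0)
    (h.sm.hasDerivAt_t hU ht) (h'.sm.hasDerivAt_t hU ht)
  refine ⟨_, ((((hD₀.add (hD₁.div_const ε)).add (hD₂.div_const (ε ^ 2))).add
    (hD₃.div_const (ε ^ 3))).add (hD₄.div_const (ε ^ 4))).add (hD₅.const_mul (2 * 10 ^ 4)), ?_⟩
  have hlp := hs.l_pos
  have hl1 := hs.one_le_l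
  have chain := hs.energy_chain (Real.exp_pos (-2 * (l t * eta (-1)))) (nsq_nonneg u t)
    (nsq_nonneg _ t) (nsq_nonneg _ t) (nsq_nonneg _ t) (nsq_nonneg _ t) (sq_nonneg _)
    (sq_nonneg _) (sq_nonneg _) (sq_nonneg _) (sq_nonneg _) i₁ i₂ i₃ i₄
  have j₀ := mul_le_mul_of_nonneg_left (exp_mul_nsq_le (u := u) (h.sm.continuous_x ht) hlp.le)
    (pow_nonneg hlp.le 3)
  have jc := conj_sq l u t (-1)
  have hEM : Real.exp (-2 * (l t * eta (-1)))
      ≤ Real.exp (-4 * (l t * eta 0) + 2 * (l t * eta (-1))) := by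
    have := mul_le_mul_of_nonneg_left hη hlp.le
    exact Real.exp_le_exp.mpr (by linarith)
  have hNM : Real.exp (-2 * (l t * eta 0))
      ≤ Real.exp (-4 * (l t * eta 0) + 2 * (l t * eta (-1))) := by
    have := mul_le_mul_of_nonneg_left hη hlp.le
    exact Real.exp_le_exp.mpr (by linarith)
  have hNN : Real.exp (-2 * (l t * eta 0)) ^ 2
      = Real.exp (-4 * (l t * eta 0) + 2 * (l t * eta (-1)))
        * Real.exp (-2 * (l t * eta (-1))) := by
    rw [← Real.exp_nat_mul, ← Real.exp_add]
    congr 1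
    push_cast
    ring
  have absorb := trade_absorb (v := u t 0) (v₂ := dt (dt u) t 0) hlp hs.ε_pos hs.ε_lt
    (Real.exp_pos _) (Real.exp_pos _).le hNN
  set E := Real.exp (-2 * (l t * eta (-1)))
  set N := Real.exp (-2 * (l t * eta 0))
  set M := Real.exp (-4 * (l t * eta 0) + 2 * (l t * eta (-1)))
  have hE : 0 < E := Real.exp_pos _
  have hN : 0 < N := Real.exp_pos _
  have hM : 0 < M := Real.exp_pos _
  have l37 : l t ^ 3 ≤ l t ^ 7 := pow_le_pow_right₀ hl1 (by norm_num)
  have b1 : l t ^ 3 * E * u t 0 ^ 2 ≤ l t ^ 7 * M * u t 0 ^ 2 := by gcongr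
  have b2 : l t ^ 3 * N * u t 0 ^ 2 ≤ l t ^ 7 * M * u t 0 ^ 2 := by gcongr
  have b3 : l t ^ 7 * N * u t 0 ^ 2 ≤ l t ^ 7 * M * u t 0 ^ 2 := by gcongr
  have b4 : 0 ≤ l t * N * dt u t 0 ^ 2 := by positivity
  have b6 : 0 ≤ l t ^ 7 * M * u t 0 ^ 2 := by positivity
  have b5 : l t ^ 3 * conj l u t (-1) ^ 2 = l t ^ 3 * (E * u t (-1) ^ 2) := by rw [jc]
  linarith

end Lyapunov

section Weight

/-- The temporal weight `s / (t (T - t))`. -/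
def timeW (T s t : ℝ) : ℝ := s / (t * (T - t))

/-- The derivative of `timeW`. -/
def timeW₁ (T s t : ℝ) : ℝ := -(s * (T - 2 * t)) / (t * (T - t)) ^ 2

/-- The second derivative of `timeW`. -/
def timeW₂ (T s t : ℝ) : ℝ :=
  2 * s / (t * (T - t)) ^ 2 + 2 * s * (T - 2 * t) ^ 2 / (t * (T - t)) ^ 3

variable {T s t ε a : ℝ}

lemma mul_sub_pos (ht : t ∈ Ioo 0 T) : 0 < t * (T - t) := mul_pos ht.1 (sub_pos.mpr ht.2)

lemma timeWeight (T s : ℝ) : TimeWeight (Ioo 0 T) (timeW T s) (timeW₁ T s) (timeW₂ T s) := by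
  have hd : ∀ t, HasDerivAt (fun t => t * (T - t)) (T - 2 * t) t := fun t =>
    ((hasDerivAt_id t).mul ((hasDerivAt_id t).const_sub T)).congr_deriv (by simp; ring)
  have hd' : ∀ t, HasDerivAt (fun t => -(s * (T - 2 * t))) (2 * s) t := fun t =>
    (((((hasDerivAt_id t).const_mul 2).const_sub T).const_mul s).neg).congr_deriv
      (by ring)
  have c : ContDiff ℝ (⊤ : ℕ∞) (fun t : ℝ => t * (T - t)) := by fun_prop
  have c' : ContDiff ℝ (⊤ : ℕ∞) (fun t : ℝ => -(s * (T - 2 * t))) := by fun_prop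
  refine ⟨?_, ?_, fun t ht => ?_, fun t ht => ?_⟩
  · exact contDiffOn_const.div c.contDiffOn fun t ht => (mul_sub_pos ht).ne'
  · exact c'.contDiffOn.div (c.pow 2).contDiffOn fun t ht => (pow_pos (mul_sub_pos ht) 2).ne'
  · have := mul_sub_pos ht
    refine ((hasDerivAt_const t s).div (hd t) this.ne').congr_deriv ?_
    simp [timeW₁]
  · have := mul_sub_pos ht
    refine ((hd' t).div ((hd t).pow 2) (pow_pos this 2).ne').congr_deriv ?_
    simp only [timeW₂, Pi.pow_apply]
    generalize t * (T - t) = d at *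
    field_simp
    push_cast
    ring

lemma timeW_small (ha : 0 ≤ a) (hε : ε ∈ Ioo (0 : ℝ) 1)
    (hs : 10 ^ 6 * ((T + T ^ 2) / ε + Real.sqrt a * T ^ 2 / Real.sqrt ε) ≤ s)
    (ht : t ∈ Ioo 0 T) :
    Small (1 / 10 ^ 6) ε a (timeW T s t) (timeW₁ T s t) (timeW₂ T s t) := by
  obtain ⟨hε0, hε1⟩ := hε
  have hT : 0 < T := ht.1.trans ht.2
  have hd := mul_sub_pos ht
  have hdT : 4 * (t * (T - t)) ≤ T ^ 2 := by linarith [sq_nonneg (T - 2 * t)]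
  have hm : (T - 2 * t) ^ 2 ≤ T ^ 2 := by linarith
  have hm' : |T - 2 * t| ≤ T := abs_le.mpr ⟨by linarith [ht.2], by linarith [ht.1]⟩
  have hr : 0 < Real.sqrt ε := Real.sqrt_pos.mpr hε0
  have k0 : 0 ≤ Real.sqrt a * T ^ 2 / Real.sqrt ε := by positivity
  have k1 : (T + T ^ 2) / ε ≤ 1 / 10 ^ 6 * s := by linarith
  have k2 : Real.sqrt a * T ^ 2 / Real.sqrt ε ≤ 1 / 10 ^ 6 * s := by
    have : 0 ≤ (T + T ^ 2) / ε := by positivity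
    linarith
  rw [div_le_iff₀ hε0] at k1
  rw [div_le_iff₀ hr] at k2
  have hT2 : 0 < T ^ 2 := by positivity
  have hs0 : 0 < s := by
    by_contra! hc
    have := mul_nonneg_of_nonpos_of_nonpos hc (neg_nonpos.mpr hε0.le)
    linarith
  have k3 : a * (T ^ 2) ^ 2 ≤ (1 / 10 ^ 6 * s) ^ 2 * ε := by
    have := pow_le_pow_left₀ (by positivity) k2 2
    rwa [mul_pow, mul_pow _ (Real.sqrt ε), Real.sq_sqrt ha, Real.sq_sqrt hε0.le] at this
  have k4 : T ^ 2 ≤ 1 / 10 ^ 6 * (ε * s) := by linarith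
  have k5 : T ≤ 1 / 10 ^ 6 * (ε * s) := by linarith
  have k6 : T ^ 2 ≤ (1 / 10 ^ 6 * (ε * s)) ^ 2 := pow_le_pow_left₀ hT.le k5 2
  have k7 : a * (4 * (t * (T - t))) ^ 2 ≤ a * (T ^ 2) ^ 2 := by gcongr
  unfold timeW timeW₁ timeW₂
  generalize t * (T - t) = d at *
  refine ⟨by norm_num, hε0, hε1, by positivity, ?_, ?_, ?_, ha, ?_⟩
  · rw [← mul_div_assoc, ← mul_div_assoc, le_div_iff₀ hd]
    linarith
  · rw [abs_div, abs_of_pos (by positivity : 0 < d ^ 2), div_pow, ← mul_div_assoc,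
      ← mul_div_assoc, abs_neg, abs_mul, abs_of_pos hs0]
    have := mul_le_mul_of_nonneg_left (hm'.trans k5) hs0.le
    exact div_le_div_of_nonneg_right (by linarith) (by positivity)
  · rw [abs_of_nonneg (by positivity), div_pow, ← mul_div_assoc, ← mul_div_assoc,
      show 2 * s / d ^ 2 = 2 * s * d / d ^ 3 by field_simp, ← add_div]
    refine div_le_div_of_nonneg_right ?_ (by positivity)
    have e1 : 2 * s * d ≤ s / 2 * (1 / 10 ^ 6 * (ε * s)) ^ 2 := by
      have := mul_le_mul_of_nonneg_left (hdT.trans k6) (by positivity : 0 ≤ s / 2)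
      linarith
    have e2 : 2 * s * (T - 2 * t) ^ 2 ≤ 2 * s * (1 / 10 ^ 6 * (ε * s)) ^ 2 :=
      mul_le_mul_of_nonneg_left (hm.trans k6) (by positivity)
    have e3 : 0 ≤ ε ^ 2 * s ^ 3 := by positivity
    linarith
  · rw [div_pow, ← mul_div_assoc, ← mul_div_assoc, le_div_iff₀ (by positivity)]
    have : 0 ≤ ε * s ^ 2 := by positivity
    linarith

lemma isAdjSol_sol {φ : ℝ → ℝ → ℝ} (h : IsAdjSol1D T ε a φ) : Sol (Ioo 0 T) ε a φ :=
  ⟨h.1.contDiffOn, h.2.1, h.2.2.1, h.2.2.2⟩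

end Weight

section Decay

open Filter Asymptotics

variable {U : Set ℝ} {ε a B : ℝ} {u : ℝ → ℝ → ℝ} {l l₁ : ℝ → ℝ} {t : ℝ}

lemma Sm.exists_bound {f : ℝ → ℝ → ℝ} (hf : Sm univ f) (T : ℝ) :
    ∃ B, ∀ t ∈ Icc 0 T, ∀ x ∈ Icc (-1 : ℝ) 0, |f t x| ≤ B := by
  obtain ⟨B, hB⟩ := (isCompact_Icc (a := (0 : ℝ)) (b := T)).prod
    (isCompact_Icc (a := (-1 : ℝ)) (b := 0)) |>.exists_bound_of_continuousOn
    (hf.continuousOn.mono (prod_mono (subset_univ _) (subset_univ _)))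
  exact ⟨B, fun t ht x hx => hB (t, x) ⟨ht, hx⟩⟩

lemma pow_mul_exp_neg_le {y : ℝ} (hy : 0 ≤ y) (n : ℕ) : y ^ n * Real.exp (-y) ≤ n.factorial := by
  have := Real.pow_div_factorial_le_exp y hy n
  rw [div_le_iff₀ (by positivity)] at this
  rw [Real.exp_neg, ← div_eq_mul_inv, div_le_iff₀ (Real.exp_pos y)]
  linarith

lemma nsq_le (hu : ∀ x ∈ Icc (-1 : ℝ) 0, |u t x| ≤ B) : nsq u t ≤ B ^ 2 := by
  have h := intervalIntegral.norm_integral_le_of_norm_le_const (a := (-1 : ℝ)) (b := 0)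
    (f := fun x => u t x ^ 2) (C := B ^ 2) fun x hx => by
      rw [uIoc_of_le (by norm_num)] at hx
      rw [Real.norm_eq_abs, abs_pow]
      exact pow_le_pow_left₀ (abs_nonneg _) (hu x ⟨hx.1.le, hx.2⟩) 2
  rw [sub_neg_eq_add, zero_add, abs_one, mul_one] at h
  exact (le_abs_self _).trans h

lemma sq_le_of_abs_le {x B : ℝ} (h : |x| ≤ B) : x ^ 2 ≤ B ^ 2 := by
  rw [← sq_abs]
  exact pow_le_pow_left₀ (abs_nonneg _) h 2

lemma energyZero_isBigO (hε : 0 ≤ ε) (hu : ∀ t ∈ U, ∀ x ∈ Icc (-1 : ℝ) 0, |u t x| ≤ B) :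
    energyZero ε u =O[𝓟 U] fun _ => (1 : ℝ) := by
  refine isBigO_principal.mpr ⟨(B ^ 2 + ε * (B ^ 2 + B ^ 2)) / 2, fun t ht => ?_⟩
  have n0 := nsq_nonneg u t
  rw [norm_one, mul_one, Real.norm_eq_abs, abs_of_nonneg (by unfold energyZero; positivity)]
  unfold energyZero
  have e0 := sq_le_of_abs_le (hu t ht 0 (by norm_num))
  have e1 := sq_le_of_abs_le (hu t ht (-1) (by norm_num))
  have := mul_le_mul_of_nonneg_left (add_le_add e0 e1) hε
  linarith [nsq_le (hu t ht)]

lemma energyOne_isBigO (hε : 0 ≤ ε) (ha : 0 ≤ a)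
    (hu : ∀ t ∈ U, ∀ x ∈ Icc (-1 : ℝ) 0, |u t x| ≤ B)
    (hux : ∀ t ∈ U, ∀ x ∈ Icc (-1 : ℝ) 0, |dx u t x| ≤ B) :
    energyOne ε a u =O[𝓟 U] fun _ => (1 : ℝ) := by
  refine isBigO_principal.mpr ⟨(ε * B ^ 2 + a * B ^ 2 + B ^ 2) / 2, fun t ht => ?_⟩
  have n0 := nsq_nonneg u t
  have n1 := nsq_nonneg (dx u) t
  rw [norm_one, mul_one, Real.norm_eq_abs, abs_of_nonneg (by unfold energyOne; positivity)]
  unfold energyOne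
  have e0 := sq_le_of_abs_le (hu t ht 0 (by norm_num))
  have e1 := mul_le_mul_of_nonneg_left (nsq_le (hux t ht)) hε
  have e2 := mul_le_mul_of_nonneg_left (nsq_le (hu t ht)) ha
  linarith

lemma exp_weight_le {y c : ℝ} (hy : 0 ≤ y) (hc : 12 ≤ c) :
    Real.exp (-2 * (y * c)) ≤ Real.exp (-y) := by
  have := mul_le_mul_of_nonneg_left hc hy
  exact Real.exp_le_exp.mpr (by linarith)

lemma powExp_isBigO (h1 : ∀ t ∈ U, 1 ≤ l t) {c : ℝ} (hc : 12 ≤ c) {k : ℤ} (hk : k ≤ 3) :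
    powExp l c k =O[𝓟 U] fun t => l t ^ 3 * Real.exp (-l t) := by
  refine isBigO_principal.mpr ⟨1, fun t ht => ?_⟩
  have hl : 0 < l t := by linarith [h1 t ht]
  rw [one_mul, Real.norm_of_nonneg (by unfold powExp; positivity),
    Real.norm_of_nonneg (by positivity)]
  have h3 : l t ^ k ≤ l t ^ 3 := by
    have := zpow_le_zpow_right₀ (h1 t ht) hk
    exact_mod_cast this
  exact mul_le_mul h3 (exp_weight_le hl.le hc) (Real.exp_pos _).le (by positivity)

lemma tradeFun_isBigO (h1 : ∀ t ∈ U, 1 ≤ l t) (h2 : ∀ t ∈ U, |l₁ t| ≤ l t ^ 2) {c : ℝ}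
    (hc : 12 ≤ c) (hc' : c ≤ 18) {v v₁ : ℝ → ℝ} (hv : ∀ t ∈ U, |v t| ≤ B)
    (hv₁ : ∀ t ∈ U, |v₁ t| ≤ B) :
    tradeFun l l₁ c v v₁ =O[𝓟 U] fun t => l t ^ 3 * Real.exp (-l t) := by
  refine isBigO_principal.mpr ⟨B * B + 1 / 2 * (37 * (B * B)), fun t ht => ?_⟩
  have hl1 := h1 t ht
  have hl : 0 < l t := by linarith
  rw [Real.norm_of_nonneg (by positivity : 0 ≤ l t ^ 3 * Real.exp (-l t)), tradeFun, norm_mul,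
    Real.norm_of_nonneg (Real.exp_pos _).le]
  have hcl : c * l t ≤ 18 * l t := mul_le_mul_of_nonneg_right hc' (by linarith)
  have hcl0 : 0 ≤ c * l t := mul_nonneg (by linarith) (by linarith)
  have b3 : |1 - 2 * c * l t| ≤ 37 * l t := abs_le.mpr ⟨by linarith, by linarith⟩
  have e0 := abs_mul_le_of_le (hv t ht) (hv t ht)
  have e1 := abs_mul_le_of_le (abs_of_pos hl).le (abs_mul_le_of_le (hv t ht) (hv₁ t ht))
  have e2 := abs_mul_le_of_le (abs_mul_le_of_le (h2 t ht) b3) e0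
  have hB : 0 ≤ B * B := mul_self_nonneg B
  have l13 : l t * (B * B) ≤ l t ^ 3 * (B * B) := by
    have : l t ^ 1 ≤ l t ^ 3 := pow_le_pow_right₀ hl1 (by norm_num)
    rw [pow_one] at this
    exact mul_le_mul_of_nonneg_right this hB
  have e3 : ‖l t * (v t * v₁ t) - 1 / 2 * (l₁ t * (1 - 2 * c * l t) * v t ^ 2)‖
      ≤ (B * B + 1 / 2 * (37 * (B * B))) * l t ^ 3 := by
    rw [Real.norm_eq_abs, sq]
    have f1 := abs_le.mp e1
    have f2 := abs_le.mp e2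
    exact abs_le.mpr ⟨by linarith, by linarith⟩
  calc _ ≤ Real.exp (-l t) * ((B * B + 1 / 2 * (37 * (B * B))) * l t ^ 3) :=
        mul_le_mul (exp_weight_le hl.le hc) e3 (norm_nonneg _) (Real.exp_pos _).le
    _ = _ := by ring

lemma carlDensity_isBigO (hε : 0 ≤ ε) (hε1 : ε ≤ 1) (ha : 0 ≤ a) (hU : IsOpen U)
    (hsm : Sm U u) (h1 : ∀ t ∈ U, 1 ≤ l t)
    (h2 : ∀ t ∈ U, |l₁ t| ≤ l t ^ 2)
    (hu : ∀ t ∈ U, ∀ x ∈ Icc (-1 : ℝ) 0, |u t x| ≤ B)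
    (hux : ∀ t ∈ U, ∀ x ∈ Icc (-1 : ℝ) 0, |dx u t x| ≤ B) :
    (fun t => ∫ x in (-1 : ℝ)..0, carlDensity ε a l l₁ u t x)
      =O[𝓟 U] fun t => l t ^ 3 * Real.exp (-l t) := by
  refine isBigO_principal.mpr ⟨(150 + a) * B ^ 2, fun t ht => ?_⟩
  have hl1 := h1 t ht
  have hlp : 0 < l t := by linarith
  rw [Real.norm_of_nonneg (by positivity : 0 ≤ l t ^ 3 * Real.exp (-l t))]
  have key : ∀ x ∈ uIoc (-1 : ℝ) 0, ‖carlDensity ε a l l₁ u t x‖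
      ≤ (150 + a) * B ^ 2 * (l t ^ 3 * Real.exp (-l t)) := by
    intro x hx
    rw [uIoc_of_le (by norm_num)] at hx
    have hx' : x ∈ Icc (-1 : ℝ) 0 := ⟨hx.1.le, hx.2⟩
    obtain ⟨hβ, hβ'⟩ := beta_bounds hx'
    obtain ⟨hη, hη'⟩ := eta_bounds hx'
    have e : carlDensity ε a l l₁ u t x = Real.exp (-2 * (l t * eta x))
        * (1 / 2 * (potential ε a l l₁ t x * (u t x * u t x))
          - 1 / 2 * (ε * ((dx u t x + l t * beta x * u t x)
            * (dx u t x + l t * beta x * u t x)))) := by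
      rw [carlDensity, TimeWeight.dx_conj hU hsm ht, conj_sq, mul_pow, ← Real.exp_nat_mul]
      rw [show ((2 : ℕ) : ℝ) * -(l t * eta x) = -2 * (l t * eta x) by push_cast; ring]
      ring
    have hB : 0 ≤ B := (abs_nonneg _).trans (hu t ht x hx')
    have hlβ : |l t * beta x| ≤ l t * (74 / 10) :=
      abs_mul_le_of_le (abs_of_pos hlp).le (abs_le.mpr ⟨by linarith, hβ'⟩)
    have hl12 : l t ≤ l t ^ 2 := by nlinarith
    have hl23 : l t ^ 2 ≤ l t ^ 3 := pow_le_pow_right₀ hl1 (by norm_num)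
    have c1 : |potential ε a l l₁ t x| ≤ (81 + a) * l t ^ 2 := by
      have d1 := abs_le.mp (abs_mul_le_of_le (abs_le.mpr ⟨by linarith, hε1⟩ : |ε| ≤ 1)
        (abs_mul_le_of_le hlβ hlβ))
      have d2 := abs_le.mp hlβ
      have d3 := abs_le.mp (abs_mul_le_of_le (h2 t ht)
        (abs_le.mpr ⟨by linarith, hη'⟩ : |eta x| ≤ 18))
      have d4 : a * 1 ≤ a * l t ^ 2 := mul_le_mul_of_nonneg_left (hl1.trans hl12) ha
      unfold potential
      exact abs_le.mpr ⟨by linarith, by linarith⟩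
    have c2 := abs_mul_le_of_le c1 (abs_mul_le_of_le (hu t ht x hx') (hu t ht x hx'))
    have c3 : |dx u t x + l t * beta x * u t x| ≤ 84 / 10 * (l t * B) := by
      have d1 := abs_le.mp (abs_mul_le_of_le hlβ (hu t ht x hx'))
      have d2 := abs_le.mp (hux t ht x hx')
      have d3 : 1 * B ≤ l t * B := mul_le_mul_of_nonneg_right hl1 hB
      exact abs_le.mpr ⟨by linarith, by linarith⟩
    have c4 := abs_mul_le_of_le (abs_le.mpr ⟨by linarith, hε1⟩ : |ε| ≤ 1)
      (abs_mul_le_of_le c3 c3)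
    have c5 : (150 + a) * B ^ 2 * l t ^ 2 ≤ (150 + a) * B ^ 2 * l t ^ 3 :=
      mul_le_mul_of_nonneg_left hl23 (by positivity)
    have c6 : 0 ≤ B ^ 2 * l t ^ 2 := by positivity
    have c7 : 0 ≤ a * (B ^ 2 * l t ^ 2) := mul_nonneg ha c6
    rw [e, norm_mul, Real.norm_of_nonneg (Real.exp_pos _).le, Real.norm_eq_abs]
    calc _ ≤ Real.exp (-l t) * ((150 + a) * B ^ 2 * l t ^ 3) := by
          refine mul_le_mul (exp_weight_le hlp.le hη) ?_ (abs_nonneg _) (Real.exp_pos _).le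
          have f2 := abs_le.mp c2
          have f4 := abs_le.mp c4
          exact abs_le.mpr ⟨by linarith, by linarith⟩
      _ = _ := by ring
  have := intervalIntegral.norm_integral_le_of_norm_le_const key
  simpa using this

theorem lyapunov_isBigO (hε : 0 ≤ ε) (hε1 : ε ≤ 1) (ha : 0 ≤ a) (hU : IsOpen U)
    (hsm : Sm U u) (h1 : ∀ t ∈ U, 1 ≤ l t)
    (h2 : ∀ t ∈ U, |l₁ t| ≤ l t ^ 2)
    (hu : ∀ t ∈ U, ∀ x ∈ Icc (-1 : ℝ) 0, |u t x| ≤ B)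
    (hux : ∀ t ∈ U, ∀ x ∈ Icc (-1 : ℝ) 0, |dx u t x| ≤ B)
    (hut : ∀ t ∈ U, ∀ x ∈ Icc (-1 : ℝ) 0, |dt u t x| ≤ B)
    (hutx : ∀ t ∈ U, ∀ x ∈ Icc (-1 : ℝ) 0, |dx (dt u) t x| ≤ B) :
    lyapunov ε a l l₁ u =O[𝓟 U] fun t => l t ^ 3 * Real.exp (-l t) := by
  obtain ⟨η₀, η₀'⟩ := eta_bounds (x := 0) (by norm_num)
  have η₁ := (eta_bounds (x := -1) (by norm_num)).1
  have p : ∀ k : ℤ, k ≤ 3 → ∀ (f : ℝ → ℝ) (c : ℝ), f =O[𝓟 U] (fun _ => (1 : ℝ)) →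
      (fun t => powExp l (eta (-1)) k t * f t / c)
        =O[𝓟 U] fun t => l t ^ 3 * Real.exp (-l t) := fun k hk f c hf => by
    have := ((powExp_isBigO h1 η₁ hk).mul hf).const_mul_left c⁻¹
    simpa only [mul_one, div_eq_inv_mul] using this
  have d := ((carlDensity_isBigO hε hε1 ha hU hsm h1 h2 hu hux).neg_left).const_mul_left
    (ε ^ 2)⁻¹
  simp only [← div_eq_inv_mul] at d
  exact ((((d.add (p 1 (by norm_num) _ _ (energyZero_isBigO hε hu))).add
    (p (-1) (by norm_num) _ _ (energyOne_isBigO hε ha hu hux))).add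
    (p (-3) (by norm_num) _ _ (energyZero_isBigO hε hut))).add
    (p (-5) (by norm_num) _ _ (energyOne_isBigO hε ha hut hutx))).add
    ((tradeFun_isBigO h1 h2 η₀ η₀' (fun t ht => hu t ht 0 (by norm_num))
      (fun t ht => hut t ht 0 (by norm_num))).const_mul_left _)

end Decay

section Integrate

open Filter Asymptotics

lemma intervalIntegrable_of_isBigO_one {T : ℝ} {f : ℝ → ℝ} (hT : 0 ≤ T)
    (hc : ContinuousOn f (Ioo 0 T)) (hb : f =O[𝓟 (Ioo 0 T)] fun _ => (1 : ℝ)) :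
    IntervalIntegrable f volume 0 T := by
  rw [intervalIntegrable_iff_integrableOn_Ioo_of_le hT]
  obtain ⟨K, hK⟩ := isBigO_principal.mp hb
  refine Integrable.of_bound (hc.aestronglyMeasurable measurableSet_Ioo) K ?_
  filter_upwards [ae_restrict_mem measurableSet_Ioo] with t ht
  simpa using hK t ht

/-- A function vanishing at the endpoints whose derivative dominates `g` forces `∫ g ≤ 0`. -/
lemma integral_nonpos_of_deriv_ge {T : ℝ} {F g : ℝ → ℝ} (hT : 0 ≤ T)
    (hF : ∀ t ∈ Ioo 0 T, ∃ D, HasDerivAt F D t ∧ g t ≤ D)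
    (hF0 : F =O[𝓟 (Ioo 0 T)] fun t => t * (T - t)) (hg : IntervalIntegrable g volume 0 T) :
    ∫ t in (0 : ℝ)..T, g t ≤ 0 := by
  classical
  obtain ⟨K, hK⟩ := isBigO_principal.mp hF0
  choose! D hD using hF
  set G : ℝ → ℝ := (Ioo 0 T).indicator F with hG
  have hGd : ∀ t ∈ Ioo 0 T, HasDerivAt G (D t) t := fun t ht =>
    (hD t ht).1.congr_of_eventuallyEq
      (eventually_of_mem (isOpen_Ioo.mem_nhds ht) fun r hr => indicator_of_mem hr F)
  have hGb : ∀ t, ‖G t‖ ≤ |K * (t * (T - t))| := fun t => by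
    by_cases ht : t ∈ Ioo 0 T
    · rw [hG, indicator_of_mem ht]
      refine (hK t ht).trans ?_
      rw [Real.norm_of_nonneg (mul_sub_pos ht).le]
      exact le_abs_self _
    · rw [hG, indicator_of_notMem ht, norm_zero]
      exact abs_nonneg _
  have hend : ∀ t, t * (T - t) = 0 → ContinuousAt G t := fun t ht => by
    have h0 : G t = 0 := norm_le_zero_iff.mp ((hGb t).trans (by simp [ht]))
    rw [ContinuousAt, h0]
    refine squeeze_zero_norm hGb ?_
    have : Continuous fun t => |K * (t * (T - t))| := by fun_prop
    simpa [ht] using this.tendsto t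
  have hcont : ContinuousOn G (Icc 0 T) := fun t ht => by
    refine ContinuousAt.continuousWithinAt ?_
    by_cases h : t ∈ Ioo 0 T
    · exact (hGd t h).continuousAt
    · refine hend t ?_
      rcases ht.1.eq_or_lt with h0 | h0
      · simp [← h0]
      · rcases ht.2.eq_or_lt with h1 | h1
        · simp [h1]
        · exact absurd ⟨h0, h1⟩ h
  have := integral_le_sub_of_hasDeriv_right_of_le hT hcont
    (fun t ht => (hGd t ht).hasDerivWithinAt)
    ((intervalIntegrable_iff_integrableOn_Icc_of_le hT).mp hg) (fun t ht => (hD t ht).2)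
  simpa [hG] using this

variable {T ε a s B t : ℝ} {u : ℝ → ℝ → ℝ}

/-- Weighted interior density. -/
def interiorDensity (l : ℝ → ℝ) (u : ℝ → ℝ → ℝ) (t : ℝ) : ℝ :=
  ∫ x in (-1 : ℝ)..0, (l t * beta x) ^ 3 * conj l u t x ^ 2

/-- Weighted boundary density. -/
def boundaryDensity (l : ℝ → ℝ) (u : ℝ → ℝ → ℝ) (t : ℝ) : ℝ :=
  (l t * beta 0) ^ 3 * conj l u t 0 ^ 2 + (l t * beta (-1)) ^ 3 * conj l u t (-1) ^ 2

/-- Weighted observation density. -/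
def observationDensity (l : ℝ → ℝ) (u : ℝ → ℝ → ℝ) (t : ℝ) : ℝ :=
  Real.exp (-4 * (l t * eta 0) + 2 * (l t * eta (-1))) * (l t * beta 0) ^ 7 * u t 0 ^ 2

section Density

variable {U : Set ℝ} {l l₁ l₂ : ℝ → ℝ}

lemma beta_pow_three_le {x : ℝ} (hx : x ∈ Icc (-1 : ℝ) 0) : beta x ^ 3 ≤ 406 := by
  obtain ⟨h, h'⟩ := beta_bounds hx
  exact (pow_le_pow_left₀ (by linarith) h' 3).trans (by norm_num)

lemma weight_cube_le (hl : 0 ≤ l t) {x y : ℝ} (hx : x ∈ Icc (-1 : ℝ) 0) :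
    (l t * beta x) ^ 3 * y ^ 2 ≤ 406 * (l t ^ 3 * y ^ 2) := by
  have := mul_le_mul_of_nonneg_right (beta_pow_three_le hx)
    (by positivity : 0 ≤ l t ^ 3 * y ^ 2)
  rw [mul_pow]
  linarith

lemma weight_cube_nonneg (hl : 0 ≤ l t) (x y : ℝ) : 0 ≤ (l t * beta x) ^ 3 * y ^ 2 := by
  have : 0 < beta x := Real.exp_pos _
  positivity

lemma boundaryDensity_nonneg (hl : 0 ≤ l t) : 0 ≤ boundaryDensity l u t :=
  add_nonneg (weight_cube_nonneg hl _ _) (weight_cube_nonneg hl _ _)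

lemma observationDensity_nonneg (hl : 0 ≤ l t) : 0 ≤ observationDensity l u t := by
  have : 0 < beta 0 := Real.exp_pos _
  unfold observationDensity
  positivity

lemma interiorDensity_le (hu : Continuous (u t)) (hl : 0 ≤ l t) :
    interiorDensity l u t ≤ 406 * (l t ^ 3 * nsq (conj l u) t) := by
  have h1 := contDiff_eta.continuous
  have h2 := contDiff_beta.continuous
  unfold interiorDensity nsq
  rw [← intervalIntegral.integral_const_mul, ← intervalIntegral.integral_const_mul]
  refine intervalIntegral.integral_mono_on (by norm_num) ?_ ?_
    fun x hx => weight_cube_le hl hx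
  all_goals
    unfold conj
    exact (by fun_prop : Continuous _).intervalIntegrable _ _

lemma observation_le (hl : 0 ≤ l t) :
    l t ^ 7 * Real.exp (-4 * (l t * eta 0) + 2 * (l t * eta (-1))) * u t 0 ^ 2
      ≤ observationDensity l u t := by
  obtain ⟨h, h'⟩ := beta_bounds (x := 0) (by norm_num)
  have h1 : l t ^ 7 ≤ (l t * beta 0) ^ 7 :=
    pow_le_pow_left₀ hl (le_mul_of_one_le_right hl (by linarith)) 7
  have := mul_le_mul_of_nonneg_right h1 (by positivity :
    0 ≤ Real.exp (-4 * (l t * eta 0) + 2 * (l t * eta (-1))) * u t 0 ^ 2)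
  unfold observationDensity
  linarith

theorem Sol.lyapunov_deriv_ge_density (hU : IsOpen U) (h : Sol U ε a u)
    (hl : TimeWeight U l l₁ l₂) (ht : t ∈ U)
    (hs : Small (1 / 10 ^ 6) ε a (l t) (l₁ t) (l₂ t)) :
    ∃ D, HasDerivAt (lyapunov ε a l l₁ u) D t ∧
      1 / 50 * (interiorDensity l u t + boundaryDensity l u t)
        - 2 * 10 ^ 9 * observationDensity l u t ≤ D := by
  obtain ⟨D, hD, h1⟩ := h.lyapunov_deriv_ge hU hl ht hs
  refine ⟨D, hD, le_trans ?_ h1⟩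
  have hlp := hs.l_pos
  have hl1 := hs.one_le_l
  have i1 := interiorDensity_le (l := l) (u := u) (h.sm.continuous_x ht) hlp.le
  have i2 := observation_le (u := u) hlp.le
  have i3 := weight_cube_le (l := l) (t := t) hlp.le (x := 0) (y := conj l u t 0) (by norm_num)
  have i4 := weight_cube_le (l := l) (t := t) hlp.le (x := -1) (y := conj l u t (-1))
    (by norm_num)
  have i5 : l t ^ 3 * conj l u t 0 ^ 2
      ≤ l t ^ 7 * Real.exp (-4 * (l t * eta 0) + 2 * (l t * eta (-1))) * u t 0 ^ 2 := by
    rw [conj_sq, ← mul_assoc]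
    have hη := mul_le_mul_of_nonneg_left (eta_anti (x := -1) (by norm_num)).1 hlp.le
    have hNM : Real.exp (-2 * (l t * eta 0))
        ≤ Real.exp (-4 * (l t * eta 0) + 2 * (l t * eta (-1))) :=
      Real.exp_le_exp.mpr (by linarith)
    have l37 : l t ^ 3 ≤ l t ^ 7 := pow_le_pow_right₀ hl1 (by norm_num)
    exact mul_le_mul_of_nonneg_right
      (mul_le_mul l37 hNM (Real.exp_pos _).le (by positivity)) (sq_nonneg _)
  have p1 : 0 ≤ l t ^ 3 * nsq (conj l u) t := mul_nonneg (by positivity) (nsq_nonneg _ _)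
  have p2 : 0 ≤ l t ^ 3 * conj l u t (-1) ^ 2 := by positivity
  have p3 := observationDensity_nonneg (u := u) hlp.le
  unfold boundaryDensity
  linarith

lemma Sm.continuousOn_t {f : ℝ → ℝ → ℝ} (hU : IsOpen U) (hf : Sm U f) (x : ℝ) :
    ContinuousOn (fun t => f t x) U := fun _ ht =>
  (hf.hasDerivAt_t hU ht).continuousAt.continuousWithinAt

lemma continuousOn_interiorDensity (hU : IsOpen U) (hl : TimeWeight U l l₁ l₂) (hu : Sm U u) :
    ContinuousOn (interiorDensity l u) U := fun _ ht =>
  (Sm.hasDerivAt_integral hU (f := fun t x => (l t * beta x) ^ 3 * conj l u t x ^ 2)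
    (Sm.mul (ContDiffOn.pow hl.sm_lbeta 3) (hl.sm_conj hu).sq) ht).continuousAt.continuousWithinAt

lemma continuousOn_boundaryDensity (hU : IsOpen U) (hl : TimeWeight U l l₁ l₂) (hu : Sm U u) :
    ContinuousOn (boundaryDensity l u) U := by
  have h1 := hl.sm.continuousOn
  have h2 := (hl.sm_conj hu).continuousOn_t hU 0
  have h3 := (hl.sm_conj hu).continuousOn_t hU (-1)
  unfold boundaryDensity
  fun_prop

lemma continuousOn_observationDensity (hU : IsOpen U) (hl : TimeWeight U l l₁ l₂)
    (hu : Sm U u) : ContinuousOn (observationDensity l u) U := by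
  have h1 := hl.sm.continuousOn
  have h2 := hu.continuousOn_t hU 0
  unfold observationDensity
  fun_prop

lemma weight_conj_le (h1 : 1 ≤ l t) {x : ℝ} (hx : x ∈ Icc (-1 : ℝ) 0) (hu : |u t x| ≤ B) :
    (l t * beta x) ^ 3 * conj l u t x ^ 2 ≤ 406 * (6 * B ^ 2) := by
  have hl : 0 ≤ l t := by linarith
  refine (weight_cube_le hl hx).trans ?_
  have e1 := mul_le_mul_of_nonneg_left (exp_weight_le hl (eta_bounds hx).1)
    (by positivity : 0 ≤ l t ^ 3)
  have e2 : l t ^ 3 * Real.exp (-l t) ≤ 6 := by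
    simpa [Nat.factorial] using pow_mul_exp_neg_le hl 3
  have e3 := mul_le_mul (e1.trans e2) (sq_le_of_abs_le hu) (sq_nonneg _) (by positivity)
  rw [conj_sq]
  linarith

lemma interiorDensity_isBigO (h1 : ∀ t ∈ U, 1 ≤ l t)
    (hu : ∀ t ∈ U, ∀ x ∈ Icc (-1 : ℝ) 0, |u t x| ≤ B) :
    interiorDensity l u =O[𝓟 U] fun _ => (1 : ℝ) := by
  refine isBigO_principal.mpr ⟨406 * (6 * B ^ 2), fun t ht => ?_⟩
  have hl : 0 ≤ l t := by linarith [h1 t ht]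
  have := intervalIntegral.norm_integral_le_of_norm_le_const (a := (-1 : ℝ)) (b := 0)
    (f := fun x => (l t * beta x) ^ 3 * conj l u t x ^ 2) (C := 406 * (6 * B ^ 2)) fun x hx => by
      rw [uIoc_of_le (by norm_num)] at hx
      have hx' : x ∈ Icc (-1 : ℝ) 0 := ⟨hx.1.le, hx.2⟩
      rw [Real.norm_of_nonneg (weight_cube_nonneg hl _ _)]
      exact weight_conj_le (h1 t ht) hx' (hu t ht x hx')
  rw [sub_neg_eq_add, zero_add, abs_one, mul_one] at this
  simpa [interiorDensity] using this

lemma boundaryDensity_isBigO (h1 : ∀ t ∈ U, 1 ≤ l t)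
    (hu : ∀ t ∈ U, ∀ x ∈ Icc (-1 : ℝ) 0, |u t x| ≤ B) :
    boundaryDensity l u =O[𝓟 U] fun _ => (1 : ℝ) := by
  refine isBigO_principal.mpr ⟨406 * (6 * B ^ 2) + 406 * (6 * B ^ 2), fun t ht => ?_⟩
  have hl : 0 ≤ l t := by linarith [h1 t ht]
  rw [norm_one, mul_one, Real.norm_of_nonneg (boundaryDensity_nonneg hl)]
  exact add_le_add (weight_conj_le (h1 t ht) (by norm_num) (hu t ht 0 (by norm_num)))
    (weight_conj_le (h1 t ht) (by norm_num) (hu t ht (-1) (by norm_num)))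

lemma observationDensity_isBigO (h1 : ∀ t ∈ U, 1 ≤ l t)
    (hu : ∀ t ∈ U, ∀ x ∈ Icc (-1 : ℝ) 0, |u t x| ≤ B) :
    observationDensity l u =O[𝓟 U] fun _ => (1 : ℝ) := by
  refine isBigO_principal.mpr ⟨beta 0 ^ 7 * 5040 * B ^ 2, fun t ht => ?_⟩
  have hl : 0 ≤ l t := by linarith [h1 t ht]
  have hβ : 0 < beta 0 := Real.exp_pos _
  rw [norm_one, mul_one, Real.norm_of_nonneg (observationDensity_nonneg hl)]
  have e1 : Real.exp (-4 * (l t * eta 0) + 2 * (l t * eta (-1))) ≤ Real.exp (-l t) := by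
    have := mul_le_mul_of_nonneg_left eta_gap hl
    exact Real.exp_le_exp.mpr (by linarith)
  have e0 : l t ^ 7 * Real.exp (-l t) ≤ 5040 := by
    simpa [Nat.factorial] using pow_mul_exp_neg_le hl 7
  have e2 := (mul_le_mul_of_nonneg_left e1 (by positivity : 0 ≤ l t ^ 7)).trans e0
  have e3 := mul_le_mul (mul_le_mul_of_nonneg_left e2 (by positivity : 0 ≤ beta 0 ^ 7))
    (sq_le_of_abs_le (hu t ht 0 (by norm_num))) (sq_nonneg _) (by positivity)
  unfold observationDensity
  rw [mul_pow]
  linarith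

end Density

theorem Sol.integral_density_le (hs0 : 0 < s) (hT : 0 < T) (h : Sm univ u)
    (hsol : Sol (Ioo 0 T) ε a u)
    (hsm : ∀ t ∈ Ioo 0 T,
      Small (1 / 10 ^ 6) ε a (timeW T s t) (timeW₁ T s t) (timeW₂ T s t)) :
    (∫ t in (0 : ℝ)..T, interiorDensity (timeW T s) u t)
      + (∫ t in (0 : ℝ)..T, boundaryDensity (timeW T s) u t)
      ≤ 10 ^ 11 * ∫ t in (0 : ℝ)..T, observationDensity (timeW T s) u t := by
  have hW := timeWeight T s
  have hm : T / 2 ∈ Ioo 0 T := ⟨by linarith, by linarith⟩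
  have hε := (hsm _ hm).ε_pos.le
  have hε1 := (hsm _ hm).ε_lt.le
  have ha := (hsm _ hm).a_nonneg
  obtain ⟨B₁, hB₁⟩ := h.exists_bound T
  obtain ⟨B₂, hB₂⟩ := (h.dx isOpen_univ).exists_bound T
  obtain ⟨B₃, hB₃⟩ := (h.dt isOpen_univ).exists_bound T
  obtain ⟨B₄, hB₄⟩ := ((h.dt isOpen_univ).dx isOpen_univ).exists_bound T
  have hl1 : ∀ t ∈ Ioo 0 T, 1 ≤ timeW T s t := fun t ht => (hsm t ht).one_le_l
  have hl2 : ∀ t ∈ Ioo 0 T, |timeW₁ T s t| ≤ timeW T s t ^ 2 := fun t ht => by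
    refine (hsm t ht).d₁_le.trans ?_
    have : ε * timeW T s t ^ 2 ≤ 1 * timeW T s t ^ 2 :=
      mul_le_mul_of_nonneg_right hε1 (by positivity)
    have : 0 ≤ timeW T s t ^ 2 := by positivity
    linarith
  have bd : ∀ {f : ℝ → ℝ → ℝ} {b : ℝ}, (∀ t ∈ Icc 0 T, ∀ x ∈ Icc (-1 : ℝ) 0, |f t x| ≤ b) →
      b ≤ max (max B₁ B₂) (max B₃ B₄) →
      ∀ t ∈ Ioo 0 T, ∀ x ∈ Icc (-1 : ℝ) 0, |f t x| ≤ max (max B₁ B₂) (max B₃ B₄) :=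
    fun hf hb t ht x hx => (hf t (Ioo_subset_Icc_self ht) x hx).trans hb
  have hu := bd hB₁ (by simp)
  have hF := lyapunov_isBigO hε hε1 ha isOpen_Ioo hsol.sm hl1 hl2 hu (bd hB₂ (by simp))
    (bd hB₃ (by simp)) (bd hB₄ (by simp))
  have hF0 : (fun t => timeW T s t ^ 3 * Real.exp (-timeW T s t))
      =O[𝓟 (Ioo 0 T)] fun t => t * (T - t) := by
    refine isBigO_principal.mpr ⟨24 / s, fun t ht => ?_⟩
    have hd := mul_sub_pos ht
    have hl := (hsm t ht).l_pos
    rw [Real.norm_of_nonneg (by positivity), Real.norm_of_nonneg hd.le, div_mul_eq_mul_div,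
      le_div_iff₀ hs0]
    have e0 : timeW T s t ^ 4 * Real.exp (-timeW T s t) ≤ 24 := by
      simpa [Nat.factorial] using pow_mul_exp_neg_le hl.le 4
    have e1 := mul_le_mul_of_nonneg_right e0 hd.le
    have e2 : timeW T s t * (t * (T - t)) = s := div_mul_cancel₀ _ hd.ne'
    have e3 : timeW T s t ^ 3 * Real.exp (-timeW T s t) * (timeW T s t * (t * (T - t)))
        ≤ 24 * (t * (T - t)) := by linarith
    rwa [e2] at e3
  have I1 := intervalIntegrable_of_isBigO_one hT.le
    (continuousOn_interiorDensity isOpen_Ioo hW hsol.sm) (interiorDensity_isBigO hl1 hu)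
  have I2 := intervalIntegrable_of_isBigO_one hT.le
    (continuousOn_boundaryDensity isOpen_Ioo hW hsol.sm) (boundaryDensity_isBigO hl1 hu)
  have I3 := intervalIntegrable_of_isBigO_one hT.le
    (continuousOn_observationDensity isOpen_Ioo hW hsol.sm) (observationDensity_isBigO hl1 hu)
  have key := integral_nonpos_of_deriv_ge hT.le
    (fun t ht => hsol.lyapunov_deriv_ge_density isOpen_Ioo hW ht (hsm t ht)) (hF.trans hF0)
    (((I1.add I2).const_mul (1 / 50)).sub (I3.const_mul (2 * 10 ^ 9)))
  rw [intervalIntegral.integral_sub ((I1.add I2).const_mul (1 / 50)) (I3.const_mul (2 * 10 ^ 9)),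
    intervalIntegral.integral_const_mul, intervalIntegral.integral_const_mul,
    intervalIntegral.integral_add I1 I2] at key
  linarith

end Integrate

section Translate

variable {T s t x : ℝ} {φ : ℝ → ℝ → ℝ}

lemma exp_carlA_eq_conj :
    Real.exp (-2 * s * carlA T t x) * φ t x ^ 2 = conj (timeW T s) φ t x ^ 2 := by
  rw [conj_sq, carlA, timeW, eta, beta]
  congr 2
  ring

lemma weight_carlW : s * carlW T t x = timeW T s t * beta x := by
  rw [carlW, timeW, beta]
  ring

lemma cube_carlW (x : ℝ) :
    s ^ 3 * (carlW T t x ^ 3 * Real.exp (-2 * s * carlA T t x) * φ t x ^ 2)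
      = (timeW T s t * beta x) ^ 3 * conj (timeW T s) φ t x ^ 2 := by
  rw [← exp_carlA_eq_conj, ← weight_carlW]
  ring

lemma integral_interiorDensity_eq :
    s ^ 3 * (∫ t in (0 : ℝ)..T, ∫ x in (-1 : ℝ)..0,
        carlW T t x ^ 3 * Real.exp (-2 * s * carlA T t x) * φ t x ^ 2)
      = ∫ t in (0 : ℝ)..T, interiorDensity (timeW T s) φ t := by
  simp only [interiorDensity, ← cube_carlW, intervalIntegral.integral_const_mul]

lemma integral_boundaryDensity_eq :
    s ^ 3 * (∫ t in (0 : ℝ)..T,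
        carlW T t 0 ^ 3 * Real.exp (-2 * s * carlA T t 0) * φ t 0 ^ 2
        + carlW T t (-1) ^ 3 * Real.exp (-2 * s * carlA T t (-1)) * φ t (-1) ^ 2)
      = ∫ t in (0 : ℝ)..T, boundaryDensity (timeW T s) φ t := by
  simp only [boundaryDensity, ← cube_carlW, ← mul_add, intervalIntegral.integral_const_mul]

lemma integral_observationDensity_eq :
    s ^ 7 * (∫ t in (0 : ℝ)..T,
        Real.exp (-4 * s * carlA T t 0 + 2 * s * carlA T t (-1)) * carlW T t 0 ^ 7 * φ t 0 ^ 2)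
      = ∫ t in (0 : ℝ)..T, observationDensity (timeW T s) φ t := by
  rw [← intervalIntegral.integral_const_mul]
  congr 1
  funext t
  have h : ∀ x, s * carlA T t x = timeW T s t * eta x := fun x => by
    rw [carlA, timeW, eta, beta]
    ring
  rw [observationDensity, ← weight_carlW, ← h, ← h, mul_assoc (-4) s, mul_assoc 2 s]
  ring

end Translate

end AdjCarleman

/-- Carleman inequality (Proposition 1.4). -/
theorem carleman_inequality :
    ∃ C > (0:ℝ), ∃ s0 > (0:ℝ), ∀ T > (0:ℝ), ∀ a ≥ (0:ℝ), ∀ ε ∈ Set.Ioo (0:ℝ) 1,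
      ∀ s ≥ s0 * ((T + T ^ 2) / ε + Real.sqrt a * T ^ 2 / Real.sqrt ε),
      ∀ φ : ℝ → ℝ → ℝ, IsAdjSol1D T ε a φ →
        s ^ 3 * (∫ t in (0:ℝ)..T, ∫ x in (-1:ℝ)..0,
              carlW T t x ^ 3 * Real.exp (-2 * s * carlA T t x) * φ t x ^ 2)
          + s ^ 3 * (∫ t in (0:ℝ)..T,
              carlW T t 0 ^ 3 * Real.exp (-2 * s * carlA T t 0) * φ t 0 ^ 2
              + carlW T t (-1) ^ 3 * Real.exp (-2 * s * carlA T t (-1)) * φ t (-1) ^ 2)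
        ≤ C * s ^ 7 * ∫ t in (0:ℝ)..T,
              Real.exp (-4 * s * carlA T t 0 + 2 * s * carlA T t (-1))
                * carlW T t 0 ^ 7 * φ t 0 ^ 2 := by
  refine ⟨10 ^ 11, by norm_num, 10 ^ 6, by norm_num, ?_⟩
  intro T hT a ha ε hε s hs φ hφ
  have hs0 : 0 < s := by
    have h1 : 0 < (T + T ^ 2) / ε := div_pos (by positivity) hε.1
    have h2 : 0 ≤ Real.sqrt a * T ^ 2 / Real.sqrt ε := by positivity
    linarith
  rw [AdjCarleman.integral_interiorDensity_eq, AdjCarleman.integral_boundaryDensity_eq, mul_assoc,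
    AdjCarleman.integral_observationDensity_eq]
  exact (AdjCarleman.isAdjSol_sol hφ).integral_density_le hs0 hT hφ.1.contDiffOn
    fun t ht => AdjCarleman.timeW_small ha hε hs ht
end
end

section
/- Weighted estimate of the second time derivative on the boundary: There exist C > 0 and s0 > 0 such that for every T > 0, every a ≥ 0, every ε ∈ (0,1), every s ≥ s0 (T + T²), and every classical solution φ of (S'^a): ε² s^{−5} ∫_0^T w(t,−1)^{−5} e^{−2 s α(t,−1)} |∂_t² φ(t,0)|² dt ≤ C ( ε² s^{−1} ∫_0^T [ (w^{−1} e^{−2sα} |∂_t φ|²)(t,0) + (w^{−1} e^{−2sα} |∂_t φ|²)(t,−1) ] dt + s^{−1} ∫∫_Q w^{−1} e^{−2sα} |∂_t φ|² dx dt ). -/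
open Real MeasureTheory intervalIntegral Set

noncomputable section

open scoped ContDiff

/-- The partial derivative in the first variable. -/
def partialT (u : ℝ → ℝ → ℝ) (t x : ℝ) : ℝ := deriv (fun s => u s x) t

/-- The partial derivative in the second variable. -/
def partialX (u : ℝ → ℝ → ℝ) (t x : ℝ) : ℝ := deriv (fun y => u t y) x

/-- Joint smoothness of a function of two real variables. -/
def IsSmooth₂ (u : ℝ → ℝ → ℝ) : Prop := ContDiff ℝ ∞ (fun p : ℝ × ℝ => u p.1 p.2)

namespace IsSmooth₂

variable {u : ℝ → ℝ → ℝ}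

lemma hasDerivAt_fst_aux (hu : IsSmooth₂ u) (t x : ℝ) :
    HasDerivAt (fun s => u s x) (fderiv ℝ (fun p : ℝ × ℝ => u p.1 p.2) (t, x) (1, 0)) t := by
  have h1 : HasFDerivAt (fun p : ℝ × ℝ => u p.1 p.2)
      (fderiv ℝ (fun p : ℝ × ℝ => u p.1 p.2) (t, x)) (t, x) :=
    (ContDiff.differentiable hu (by simp) _).hasFDerivAt
  have h2 : HasDerivAt (fun s : ℝ => (s, x)) ((1 : ℝ), (0 : ℝ)) t :=
    (hasDerivAt_id t).prodMk (hasDerivAt_const t x)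
  exact h1.comp_hasDerivAt t h2

lemma hasDerivAt_snd_aux (hu : IsSmooth₂ u) (t x : ℝ) :
    HasDerivAt (fun y => u t y) (fderiv ℝ (fun p : ℝ × ℝ => u p.1 p.2) (t, x) (0, 1)) x := by
  have h1 : HasFDerivAt (fun p : ℝ × ℝ => u p.1 p.2)
      (fderiv ℝ (fun p : ℝ × ℝ => u p.1 p.2) (t, x)) (t, x) :=
    (ContDiff.differentiable hu (by simp) _).hasFDerivAt
  have h2 : HasDerivAt (fun y : ℝ => (t, y)) ((0 : ℝ), (1 : ℝ)) x :=
    (hasDerivAt_const x t).prodMk (hasDerivAt_id x)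
  exact h1.comp_hasDerivAt x h2

lemma partialT_eq (hu : IsSmooth₂ u) :
    partialT u = fun t x => fderiv ℝ (fun p : ℝ × ℝ => u p.1 p.2) (t, x) (1, 0) := by
  ext t x
  exact (hu.hasDerivAt_fst_aux t x).deriv

lemma partialX_eq (hu : IsSmooth₂ u) :
    partialX u = fun t x => fderiv ℝ (fun p : ℝ × ℝ => u p.1 p.2) (t, x) (0, 1) := by
  ext t x
  exact (hu.hasDerivAt_snd_aux t x).deriv

lemma hasDerivAt_fst (hu : IsSmooth₂ u) (t x : ℝ) :
    HasDerivAt (fun s => u s x) (partialT u t x) t := by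
  rw [hu.partialT_eq]
  exact hu.hasDerivAt_fst_aux t x

lemma hasDerivAt_snd (hu : IsSmooth₂ u) (t x : ℝ) :
    HasDerivAt (fun y => u t y) (partialX u t x) x := by
  rw [hu.partialX_eq]
  exact hu.hasDerivAt_snd_aux t x

lemma contDiff_fderiv (hu : IsSmooth₂ u) :
    ContDiff ℝ ∞ (fderiv ℝ (fun p : ℝ × ℝ => u p.1 p.2)) :=
  ContDiff.fderiv_right hu (by simp)

lemma partialT (hu : IsSmooth₂ u) : IsSmooth₂ (partialT u) := by
  rw [hu.partialT_eq]
  exact hu.contDiff_fderiv.clm_apply contDiff_const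

lemma partialX (hu : IsSmooth₂ u) : IsSmooth₂ (partialX u) := by
  rw [hu.partialX_eq]
  exact hu.contDiff_fderiv.clm_apply contDiff_const

lemma partialT_partialX (hu : IsSmooth₂ u) (t x : ℝ) :
    _root_.partialT (_root_.partialX u) t x = _root_.partialX (_root_.partialT u) t x := by
  rw [hu.partialX.partialT_eq, hu.partialT.partialX_eq, hu.partialT_eq, hu.partialX_eq]
  have hd : DifferentiableAt ℝ (fderiv ℝ (fun p : ℝ × ℝ => u p.1 p.2)) (t, x) :=
    hu.contDiff_fderiv.differentiable (by simp) _
  have hsymm : IsSymmSndFDerivAt ℝ (fun p : ℝ × ℝ => u p.1 p.2) (t, x) :=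
    (ContDiff.contDiffAt hu).isSymmSndFDerivAt (by simpa using WithTop.coe_le_coe.2 (le_top : (2 : ℕ∞) ≤ ⊤))
  have key : ∀ v w : ℝ × ℝ, fderiv ℝ (fun p : ℝ × ℝ =>
      fderiv ℝ (fun p : ℝ × ℝ => u p.1 p.2) (p.1, p.2) v) (t, x) w =
      fderiv ℝ (fderiv ℝ (fun p : ℝ × ℝ => u p.1 p.2)) (t, x) w v := by
    intro v w
    have := (hd.hasFDerivAt.clm_apply (hasFDerivAt_const v (t, x))).fderiv
    simp only [Prod.mk.eta]
    rw [this]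
    simp
  simp only [key]
  exact hsymm.eq _ _

lemma continuous (hu : IsSmooth₂ u) : Continuous (fun p : ℝ × ℝ => u p.1 p.2) :=
  ContDiff.continuous hu

lemma continuous_fst (hu : IsSmooth₂ u) (x : ℝ) : Continuous (fun t => u t x) :=
  hu.continuous.comp (by fun_prop : Continuous fun t : ℝ => (t, x))

lemma continuous_snd (hu : IsSmooth₂ u) (t : ℝ) : Continuous (fun x => u t x) :=
  hu.continuous.comp (by fun_prop : Continuous fun x : ℝ => (t, x))

lemma continuous_integral (hu : IsSmooth₂ u) (b c : ℝ) :
    Continuous (fun t => ∫ x in b..c, u t x) :=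
  continuous_parametric_intervalIntegral_of_continuous' hu.continuous b c

lemma hasDerivAt_integral (hu : IsSmooth₂ u) (t b c : ℝ) :
    HasDerivAt (fun s => ∫ x in b..c, u s x) (∫ x in b..c, _root_.partialT u t x) t := by
  obtain ⟨M, hM⟩ := (isCompact_Icc.prod isCompact_uIcc :
    IsCompact (Icc (t - 1) (t + 1) ×ˢ uIcc b c)).exists_bound_of_continuousOn
      hu.partialT.continuous.continuousOn
  refine (intervalIntegral.hasDerivAt_integral_of_dominated_loc_of_deriv_le
    (s := Icc (t - 1) (t + 1)) (bound := fun _ => M) (F := u)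
    (Icc_mem_nhds (by linarith) (by linarith)) ?_ ?_ ?_ ?_ ?_ ?_).2
  · exact Filter.Eventually.of_forall fun s => (hu.continuous_snd s).aestronglyMeasurable
  · exact (hu.continuous_snd t).intervalIntegrable b c
  · exact (hu.partialT.continuous_snd t).aestronglyMeasurable
  · exact Filter.Eventually.of_forall fun x hx s hs =>
      hM (s, x) ⟨hs, uIoc_subset_uIcc hx⟩
  · exact intervalIntegrable_const
  · exact Filter.Eventually.of_forall fun x _ s _ => hu.hasDerivAt_fst s x

lemma hasDerivAt_integral_sq (hu : IsSmooth₂ u) (t b c : ℝ) :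
    HasDerivAt (fun s => ∫ x in b..c, u s x ^ 2)
      (2 * ∫ x in b..c, u t x * _root_.partialT u t x) t := by
  have h2 : IsSmooth₂ (fun t x => u t x ^ 2) := ContDiff.pow hu 2
  convert h2.hasDerivAt_integral t b c using 1
  rw [← intervalIntegral.integral_const_mul]
  congr 1
  ext x
  have := ((hu.hasDerivAt_fst t x).pow 2).deriv
  simp only [_root_.partialT] at this ⊢
  rw [show (fun s => u s x ^ 2) = (fun s => u s x) ^ 2 from rfl, this]
  simp
  ring

lemma continuous_integral_sq (hu : IsSmooth₂ u) (b c : ℝ) :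
    Continuous (fun t => ∫ x in b..c, u t x ^ 2) :=
  IsSmooth₂.continuous_integral (u := fun t x => u t x ^ 2) (ContDiff.pow hu 2) b c

end IsSmooth₂

section Spatial

variable {ε a : ℝ} {v v₁ v₂ z z₁ : ℝ → ℝ}

/-- Multiplication of the spatial equation by the unknown. -/
lemma adjoint_identity_mul_self
    (hv : ∀ x, HasDerivAt v (v₁ x) x) (hv₁ : ∀ x, HasDerivAt v₁ (v₂ x) x) (hz : Continuous z)
    (heq : ∀ x ∈ Ioo (-1 : ℝ) 0, z x + v₁ x + ε * v₂ x - a * v x = 0)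
    (h0 : ε * (z 0 - v₁ 0) - v 0 = 0) (h1 : z (-1) + v₁ (-1) = 0) :
    (∫ x in (-1 : ℝ)..0, v x * z x) + ε * (v 0 * z 0 + v (-1) * z (-1)) =
      (v 0 ^ 2 + v (-1) ^ 2) / 2 + ε * (∫ x in (-1 : ℝ)..0, v₁ x ^ 2)
        + a * (∫ x in (-1 : ℝ)..0, v x ^ 2) := by
  have cv : Continuous v := continuous_iff_continuousAt.2 fun x => (hv x).continuousAt
  have cv₁ : Continuous v₁ := continuous_iff_continuousAt.2 fun x => (hv₁ x).continuousAt
  have key := integral_eq_sub_of_hasDerivAt_of_le (a := (-1 : ℝ)) (b := 0) (by norm_num)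
    (f := fun x => v x ^ 2 / 2 + ε * (v x * v₁ x))
    (f' := fun x => a * v x ^ 2 + ε * v₁ x ^ 2 - v x * z x) (by fun_prop) (fun x hx => by
      have := (((hv x).pow 2).div_const 2).add (((hv x).mul (hv₁ x)).const_mul ε)
      refine this.congr_deriv ?_
      simp only [Nat.cast_ofNat, Nat.add_one_sub_one, pow_one]
      linear_combination v x * heq x hx)
    ((by fun_prop : Continuous _).intervalIntegrable _ _)
  rw [intervalIntegral.integral_sub ((by fun_prop : Continuous _).intervalIntegrable _ _)
      ((by fun_prop : Continuous _).intervalIntegrable _ _),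
    intervalIntegral.integral_add ((by fun_prop : Continuous _).intervalIntegrable _ _)
      ((by fun_prop : Continuous _).intervalIntegrable _ _),
    intervalIntegral.integral_const_mul, intervalIntegral.integral_const_mul] at key
  linear_combination -key + v 0 * h0 + ε * v (-1) * h1

/-- Multiplication of the spatial equation by the time derivative of the unknown. -/
lemma adjoint_identity_mul_deriv
    (hv : ∀ x, HasDerivAt v (v₁ x) x) (hv₁ : ∀ x, HasDerivAt v₁ (v₂ x) x)
    (hz : ∀ x, HasDerivAt z (z₁ x) x) (hz₁ : Continuous z₁)
    (heq : ∀ x ∈ Ioo (-1 : ℝ) 0, z x + v₁ x + ε * v₂ x - a * v x = 0)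
    (h0 : ε * (z 0 - v₁ 0) - v 0 = 0) (h1 : z (-1) + v₁ (-1) = 0) :
    ε * (∫ x in (-1 : ℝ)..0, v₁ x * z₁ x) + a * (∫ x in (-1 : ℝ)..0, v x * z x) + v 0 * z 0 =
      (∫ x in (-1 : ℝ)..0, z x ^ 2) + (∫ x in (-1 : ℝ)..0, v₁ x * z x)
        + ε * (z 0 ^ 2 + z (-1) ^ 2) := by
  have cv : Continuous v := continuous_iff_continuousAt.2 fun x => (hv x).continuousAt
  have cv₁ : Continuous v₁ := continuous_iff_continuousAt.2 fun x => (hv₁ x).continuousAt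
  have cz : Continuous z := continuous_iff_continuousAt.2 fun x => (hz x).continuousAt
  have key := integral_eq_sub_of_hasDerivAt_of_le (a := (-1 : ℝ)) (b := 0) (by norm_num)
    (f := fun x => ε * (v₁ x * z x))
    (f' := fun x => ε * (v₁ x * z₁ x) + a * (v x * z x) - (z x ^ 2 + v₁ x * z x)) (by fun_prop)
    (fun x hx => by
      refine (((hv₁ x).mul (hz x)).const_mul ε).congr_deriv ?_
      linear_combination z x * heq x hx)
    ((by fun_prop : Continuous _).intervalIntegrable _ _)
  rw [intervalIntegral.integral_sub ((by fun_prop : Continuous _).intervalIntegrable _ _)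
      ((by fun_prop : Continuous _).intervalIntegrable _ _),
    intervalIntegral.integral_add ((by fun_prop : Continuous _).intervalIntegrable _ _)
      ((by fun_prop : Continuous _).intervalIntegrable _ _),
    intervalIntegral.integral_add ((by fun_prop : Continuous _).intervalIntegrable _ _)
      ((by fun_prop : Continuous _).intervalIntegrable _ _),
    intervalIntegral.integral_const_mul, intervalIntegral.integral_const_mul] at key
  linear_combination key - z 0 * h0 - ε * z (-1) * h1

lemma integral_sq_add_integral_mul_ge (cv₁ : Continuous v₁) (cz : Continuous z) :
    -(∫ x in (-1 : ℝ)..0, v₁ x ^ 2) / 4 ≤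
      (∫ x in (-1 : ℝ)..0, z x ^ 2) + ∫ x in (-1 : ℝ)..0, v₁ x * z x := by
  have h : 0 ≤ ∫ x in (-1 : ℝ)..0, (v₁ x ^ 2 / 4 + (z x ^ 2 + v₁ x * z x)) :=
    intervalIntegral.integral_nonneg (by norm_num) fun x _ => by
      nlinarith [sq_nonneg (v₁ x / 2 + z x)]
  rw [intervalIntegral.integral_add ((by fun_prop : Continuous _).intervalIntegrable _ _)
      ((by fun_prop : Continuous _).intervalIntegrable _ _),
    intervalIntegral.integral_add ((by fun_prop : Continuous _).intervalIntegrable _ _)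
      ((by fun_prop : Continuous _).intervalIntegrable _ _),
    intervalIntegral.integral_div] at h
  linarith

end Spatial

section Weight

/-- The time weight `p e^{-c/p}` with `p = t (T - t)`. -/
def timeWeight (T c t : ℝ) : ℝ := t * (T - t) * Real.exp (-c / (t * (T - t)))

lemma timeWeight_zero (T c : ℝ) : timeWeight T c 0 = 0 := by simp [timeWeight]

lemma timeWeight_self (T c : ℝ) : timeWeight T c T = 0 := by simp [timeWeight]

lemma mul_sub_nonneg_of_mem_Icc {T t : ℝ} (ht : t ∈ Icc 0 T) : 0 ≤ t * (T - t) :=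
  mul_nonneg ht.1 (sub_nonneg.2 ht.2)

lemma timeWeight_nonneg {T t : ℝ} (c : ℝ) (ht : t ∈ Icc 0 T) : 0 ≤ timeWeight T c t :=
  mul_nonneg (mul_sub_nonneg_of_mem_Icc ht) (Real.exp_pos _).le

lemma timeWeight_anti {T t c c' : ℝ} (hc : c ≤ c') (ht : t ∈ Icc 0 T) :
    timeWeight T c' t ≤ timeWeight T c t := by
  have := mul_sub_nonneg_of_mem_Icc ht
  unfold timeWeight
  gcongr

lemma timeWeight_le {T t c : ℝ} (hc : 0 ≤ c) (ht : t ∈ Icc 0 T) :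
    timeWeight T c t ≤ t * (T - t) := by
  simpa [timeWeight] using timeWeight_anti hc ht

lemma continuousOn_mul_exp_neg_div {c : ℝ} (hc : 0 ≤ c) :
    ContinuousOn (fun p : ℝ => p * Real.exp (-c / p)) (Ici 0) := by
  intro p hp
  rcases eq_or_lt_of_le (mem_Ici.1 hp) with rfl | hp
  · rw [ContinuousWithinAt, zero_mul]
    refine squeeze_zero' (g := fun p => p) ?_ ?_ ?_
    · filter_upwards [self_mem_nhdsWithin] with p hp
      exact mul_nonneg hp (Real.exp_pos _).le
    · filter_upwards [self_mem_nhdsWithin] with p hp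
      refine mul_le_of_le_one_right hp (Real.exp_le_one_iff.2 ?_)
      exact div_nonpos_of_nonpos_of_nonneg (by linarith) hp
    · exact (continuous_id.tendsto' 0 0 rfl).mono_left nhdsWithin_le_nhds
  · have : p ≠ 0 := hp.ne'
    exact ContinuousAt.continuousWithinAt (by fun_prop (disch := assumption))

lemma continuousOn_timeWeight {T c : ℝ} (hc : 0 ≤ c) :
    ContinuousOn (timeWeight T c) (Icc 0 T) :=
  (continuousOn_mul_exp_neg_div hc).comp (f := fun t => t * (T - t))
    (by fun_prop) fun _ ht => mul_sub_nonneg_of_mem_Icc ht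

lemma hasDerivAt_pow_mul_timeWeight {T c t : ℝ} (n : ℕ) (ht : t ∈ Ioo 0 T) :
    HasDerivAt (fun t => (t * (T - t)) ^ (n + 1) * timeWeight T c t)
      (((n + 2) * (t * (T - t)) ^ (n + 1) + c * (t * (T - t)) ^ n) * (T - 2 * t)
        * Real.exp (-c / (t * (T - t)))) t := by
  have hp : t * (T - t) ≠ 0 := (mul_pos ht.1 (sub_pos.2 ht.2)).ne'
  have hd : HasDerivAt (fun t => t * (T - t)) (T - 2 * t) t :=
    ((hasDerivAt_id t).mul ((hasDerivAt_id t).const_sub T)).congr_deriv (by simp; ring)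
  have he := ((hasDerivAt_const t (-c)).fun_div hd hp).exp
  have h := (hd.fun_pow (n + 1)).fun_mul (hd.fun_mul he)
  refine h.congr_deriv ?_
  rw [Nat.add_sub_cancel, pow_succ]
  push_cast
  generalize T - 2 * t = q
  generalize t * (T - t) = p at hp ⊢
  generalize Real.exp (-c / p) = e
  field_simp
  ring

lemma carlW_inv_mul_exp (T s t x : ℝ) :
    (carlW T t x)⁻¹ * Real.exp (-2 * s * carlA T t x) =
      Real.exp (-(2 + x)) * timeWeight T (2 * s * (Real.exp 3 - Real.exp (2 + x))) t := by
  rw [carlW, carlA, timeWeight, inv_div, Real.exp_neg]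
  rw [show -2 * s * ((Real.exp 3 - Real.exp (2 + x)) / (t * (T - t))) =
    -(2 * s * (Real.exp 3 - Real.exp (2 + x))) / (t * (T - t)) by ring]
  ring

lemma carlW_pow_inv_mul_exp (T s t : ℝ) :
    (carlW T t (-1) ^ 5)⁻¹ * Real.exp (-2 * s * carlA T t (-1)) =
      (Real.exp 1 ^ 5)⁻¹ * ((t * (T - t)) ^ 4 *
        timeWeight T (2 * s * (Real.exp 3 - Real.exp 1)) t) := by
  have h : (2 : ℝ) + -1 = 1 := by norm_num
  rw [carlW, carlA, timeWeight, h, div_pow, inv_div]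
  rw [show -2 * s * ((Real.exp 3 - Real.exp 1) / (t * (T - t))) =
    -(2 * s * (Real.exp 3 - Real.exp 1)) / (t * (T - t)) by ring]
  ring

lemma carl_exponent_nonneg {s x : ℝ} (hs : 0 ≤ s) (hx : x ≤ 0) :
    0 ≤ 2 * s * (Real.exp 3 - Real.exp (2 + x)) := by
  have : Real.exp (2 + x) ≤ Real.exp 3 := Real.exp_le_exp.2 (by linarith)
  have := sub_nonneg.2 this
  positivity

lemma timeWeight_le_carl {T s t x : ℝ} (hs : 0 ≤ s) (ht : t ∈ Icc 0 T) (hx : x ∈ Icc (-1 : ℝ) 0) :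
    Real.exp (-2) * timeWeight T (2 * s * (Real.exp 3 - Real.exp 1)) t ≤
      (carlW T t x)⁻¹ * Real.exp (-2 * s * carlA T t x) := by
  rw [carlW_inv_mul_exp]
  have h1 : Real.exp 1 ≤ Real.exp (2 + x) := Real.exp_le_exp.2 (by linarith [hx.1])
  have h2 : timeWeight T (2 * s * (Real.exp 3 - Real.exp 1)) t ≤
      timeWeight T (2 * s * (Real.exp 3 - Real.exp (2 + x))) t :=
    timeWeight_anti (by gcongr) ht
  have h3 : Real.exp (-2) ≤ Real.exp (-(2 + x)) := Real.exp_le_exp.2 (by linarith [hx.2])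
  exact mul_le_mul h3 h2 (timeWeight_nonneg _ ht) (Real.exp_pos _).le

lemma continuousOn_carl {T s x : ℝ} (hs : 0 ≤ s) (hx : x ≤ 0) :
    ContinuousOn (fun t => (carlW T t x)⁻¹ * Real.exp (-2 * s * carlA T t x)) (Icc 0 T) := by
  simp only [carlW_inv_mul_exp]
  exact continuousOn_const.mul (continuousOn_timeWeight (carl_exponent_nonneg hs hx))

lemma continuous_carl_snd (T s t : ℝ) :
    Continuous (fun x => (carlW T t x)⁻¹ * Real.exp (-2 * s * carlA T t x)) := by
  simp only [carlW_inv_mul_exp, timeWeight]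
  fun_prop

lemma intervalIntegrable_integral_carl {T s : ℝ} (hT : 0 ≤ T) (hs : 0 ≤ s) {u : ℝ → ℝ → ℝ}
    (hu : Continuous fun p : ℝ × ℝ => u p.1 p.2) :
    IntervalIntegrable (fun t => ∫ x in (-1 : ℝ)..0,
      (carlW T t x)⁻¹ * Real.exp (-2 * s * carlA T t x) * u t x) volume 0 T := by
  obtain ⟨M, hM⟩ := (isCompact_Icc.prod isCompact_Icc :
    IsCompact (Icc (0 : ℝ) T ×ˢ Icc (-1 : ℝ) 0)).exists_bound_of_continuousOn
      hu.continuousOn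
  have hmeas : Measurable fun p : ℝ × ℝ =>
      (carlW T p.1 p.2)⁻¹ * Real.exp (-2 * s * carlA T p.1 p.2) * u p.1 p.2 := by
    have := hu.measurable
    unfold carlW carlA
    fun_prop
  have hint : Integrable (fun p : ℝ × ℝ =>
      (carlW T p.1 p.2)⁻¹ * Real.exp (-2 * s * carlA T p.1 p.2) * u p.1 p.2)
      ((volume.restrict (Ioc 0 T)).prod (volume.restrict (Ioc (-1 : ℝ) 0))) := by
    refine Integrable.of_bound hmeas.aestronglyMeasurable (T * T * M) ?_
    rw [Measure.prod_restrict]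
    refine (ae_restrict_iff' (measurableSet_Ioc.prod measurableSet_Ioc)).2
      (Filter.Eventually.of_forall ?_)
    rintro ⟨t, x⟩ ⟨ht, hx⟩
    have ht' : t ∈ Icc 0 T := Ioc_subset_Icc_self ht
    have hx' : x ∈ Icc (-1 : ℝ) 0 := Ioc_subset_Icc_self hx
    simp only at ht' hx' ⊢
    have hM' := hM (t, x) ⟨ht', hx'⟩
    have hw := timeWeight_nonneg (2 * s * (Real.exp 3 - Real.exp (2 + x))) ht'
    have hw' := timeWeight_le (carl_exponent_nonneg hs hx'.2) ht'
    have he : Real.exp (-(2 + x)) ≤ 1 := Real.exp_le_one_iff.2 (by linarith [hx'.1])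
    rw [carlW_inv_mul_exp, norm_mul, norm_mul, Real.norm_of_nonneg (Real.exp_pos _).le,
      Real.norm_of_nonneg hw]
    have hTT : t * (T - t) ≤ T * T :=
      mul_le_mul ht'.2 (by linarith [ht'.1]) (by linarith [ht'.2]) hT
    refine mul_le_mul ?_ hM' (norm_nonneg _) (by positivity)
    calc _ ≤ 1 * (T * T) := mul_le_mul he (hw'.trans hTT) hw zero_le_one
      _ = T * T := one_mul _
  rw [intervalIntegrable_iff_integrableOn_Ioc_of_le hT]
  simpa only [intervalIntegral.integral_of_le (show (-1 : ℝ) ≤ 0 by norm_num)]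
    using! hint.integral_prod_left

end Weight

/-- Pointwise-in-time lower bound for the derivative of the Lyapunov functional. -/
lemma lyapunov_deriv_lower_bound {ε a s T p e q c M A D b₀ b₁ z dF dE : ℝ}
    (hε : 0 < ε) (hε1 : ε < 1) (ha : 0 ≤ a) (hT : 0 < T) (hs : T ≤ s) (hp : 0 ≤ p) (hps : p ≤ s)
    (he : 0 ≤ e) (hq : |q| ≤ T) (hc : 0 ≤ c) (hM : 5 * s + c = M * s) (hM1 : 1 ≤ M)
    (hA : 0 ≤ A) (hD : 0 ≤ D) (hb₀ : 0 ≤ b₀) (hb₁ : 0 ≤ b₁)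
    (hF : 2 * (ε * z ^ 2 - D / 4) ≤ dF)
    (hE : dE = 2 * ((b₀ + b₁) / 2 + ε * D + a * A)) :
    ε ^ 2 * (p ^ 5 * e) * z ^ 2 - M ^ 2 * s ^ 4 * (p * e) * (A + ε ^ 2 * (b₀ + b₁)) ≤
      ε / 2 * ((5 * p ^ 4 + c * p ^ 3) * q * e * (ε * D + a * A + b₀) + p ^ 5 * e * dF)
      + 1 / 2 * (((5 * p ^ 4 + c * p ^ 3) * q * e
            + ε * (M * s * T * ((3 * p ^ 2 + c * p) * q * e))) * (A + ε * (b₀ + b₁))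
        + (p ^ 5 * e + ε * (M * s * T * (p ^ 3 * e))) * dE) := by
  have hs0 : 0 < s := hT.trans_le hs
  have hM0 : 0 ≤ M := by linarith
  set θ := p ^ 5 * e with hθ
  set θ' := (5 * p ^ 4 + c * p ^ 3) * q * e with hθ'
  set K := M * s * T * (p ^ 3 * e) with hK
  set K' := M * s * T * ((3 * p ^ 2 + c * p) * q * e) with hK'
  set N := M ^ 2 * s ^ 4 * (p * e) with hN
  have θ0 : 0 ≤ θ := by positivity
  have K0 : 0 ≤ K := by positivity
  have N0 : 0 ≤ N := by positivity
  have hθ'K : |θ'| ≤ K := by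
    have h1 : 5 * p ^ 4 + c * p ^ 3 ≤ M * s * p ^ 3 := by
      rw [← hM]
      linear_combination 5 * mul_le_mul_of_nonneg_left hps (pow_nonneg hp 3)
    rw [hθ', abs_mul, abs_mul, abs_of_nonneg he, abs_of_nonneg (by positivity), hK]
    calc _ ≤ M * s * p ^ 3 * T * e := by gcongr
      _ = _ := by ring
  have hK'N : |K'| ≤ N := by
    have h1 : 3 * p ^ 2 + c * p ≤ M * s * p := by
      rw [← hM]
      linear_combination 3 * mul_le_mul_of_nonneg_left hps hp + 2 * mul_nonneg hs0.le hp
    have h2 : 0 ≤ M * s * T := by positivity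
    rw [hK', abs_mul, abs_of_nonneg h2, abs_mul, abs_mul, abs_of_nonneg he, abs_of_nonneg (a := 3 * p ^ 2 + c * p) (by positivity), hN]
    calc _ ≤ M * s * s * (M * s * p * s * e) := by gcongr; exact hq.trans hs
      _ = _ := by ring
  have hKN : K ≤ N := by
    calc K = M * s * T * (p ^ 2 * (p * e)) := by rw [hK]; ring
      _ ≤ M * s * s * (s ^ 2 * (p * e)) := by gcongr
      _ = M * 1 * s ^ 4 * (p * e) := by ring
      _ ≤ M * M * s ^ 4 * (p * e) := by gcongr
      _ = N := by rw [hN]; ring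
  have hKθ : K ^ 2 ≤ θ * N := by
    calc K ^ 2 = M ^ 2 * s ^ 2 * T ^ 2 * (p ^ 6 * e ^ 2) := by rw [hK]; ring
      _ ≤ M ^ 2 * s ^ 2 * s ^ 2 * (p ^ 6 * e ^ 2) := by gcongr
      _ = θ * N := by rw [hθ, hN]; ring
  have hεK : ε * K ≤ θ + ε ^ 2 * N / 4 := by
    refine abs_le_of_sq_le_sq' ?_ (by positivity) |>.2
    linear_combination sq_nonneg (θ - ε ^ 2 * N / 4) + mul_le_mul_of_nonneg_left hKθ (sq_nonneg ε)
  obtain ⟨t1, t2⟩ := abs_le.1 hθ'K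
  obtain ⟨k1, k2⟩ := abs_le.1 hK'N
  have i1 : 0 ≤ ε * (K + θ') * (ε * D + a * A + b₀) := by
    have : 0 ≤ K + θ' := by linarith
    positivity
  have i2 : 0 ≤ ε * θ * (dF - 2 * (ε * z ^ 2 - D / 4)) :=
    mul_nonneg (by positivity) (by linarith)
  have i3 : 0 ≤ (θ' + N) * A := mul_nonneg (by linarith) hA
  have i4 : 0 ≤ ε * (K' + N) * A := mul_nonneg (mul_nonneg hε.le (by linarith)) hA
  have i5 : 0 ≤ (1 - ε) * N * A := mul_nonneg (mul_nonneg (by linarith) N0) hA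
  have hεθ' : 0 ≤ ε * (θ' + K) := mul_nonneg hε.le (by linarith)
  have i6 : 0 ≤ (ε * θ' + (θ + ε ^ 2 * N / 4)) * (b₀ + b₁) :=
    mul_nonneg (by linarith) (by linarith)
  have i7 : 0 ≤ ε ^ 2 * (K' + N) * (b₀ + b₁) :=
    mul_nonneg (mul_nonneg (by positivity) (by linarith)) (by linarith)
  have i8 : 0 ≤ θ * (ε * D) := by positivity
  have i9 : 0 ≤ θ * (a * A) := by positivity
  have i10 : 0 ≤ ε * K * (ε * D + a * A + b₁) := by positivity
  have i11 : 0 ≤ ε ^ 2 * N * (b₀ + b₁) := by positivity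
  rw [hE]
  clear_value θ θ' K K' N
  linear_combination 1 / 2 * i1 + 1 / 2 * i2 + 1 / 2 * i3 + 1 / 2 * i4 + 1 / 2 * i5 + 1 / 2 * i6
    + 1 / 2 * i7 + 3 / 4 * i8 + i9 + 1 / 2 * i10 + 3 / 8 * i11

lemma HasDerivAt.eq_zero_of_forall_Ioo {g : ℝ → ℝ} {g' b c t : ℝ} (hg : HasDerivAt g g' t)
    (h : ∀ s ∈ Ioo b c, g s = 0) (ht : t ∈ Ioo b c) : g' = 0 :=
  hg.unique ((hasDerivAt_const t (0 : ℝ)).congr_of_eventuallyEq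
    (Filter.eventually_of_mem (isOpen_Ioo.mem_nhds ht) h))

/-- The system is autonomous, hence stable under time differentiation. -/
lemma IsAdjSol1D.partialT {T ε a : ℝ} {φ : ℝ → ℝ → ℝ} (h : IsAdjSol1D T ε a φ) :
    IsAdjSol1D T ε a (_root_.partialT φ) := by
  obtain ⟨hφ, hpde, hbc0, hbc1⟩ := h
  have hφ : IsSmooth₂ φ := hφ
  have hx (t x : ℝ) : HasDerivAt (fun s => partialX φ s x)
      (partialX (_root_.partialT φ) t x) t := by
    rw [← hφ.partialT_partialX]
    exact hφ.partialX.hasDerivAt_fst t x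
  have hxx (t x : ℝ) : HasDerivAt (fun s => partialX (partialX φ) s x)
      (partialX (partialX (_root_.partialT φ)) t x) t := by
    have : partialX (_root_.partialT φ) = _root_.partialT (partialX φ) := by
      ext t x
      exact (hφ.partialT_partialX t x).symm
    rw [this, ← hφ.partialX.partialT_partialX]
    exact hφ.partialX.partialX.hasDerivAt_fst t x
  refine ⟨hφ.partialT, fun t ht x hx' => ?_, fun t ht => ?_, fun t ht => ?_⟩
  · exact ((((hφ.partialT.hasDerivAt_fst t x).add (hx t x)).add ((hxx t x).const_mul ε)).sub
      ((hφ.hasDerivAt_fst t x).const_mul a)).eq_zero_of_forall_Ioo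
      (fun s hs => hpde s hs x hx') ht
  · exact ((((hφ.partialT.hasDerivAt_fst t 0).sub (hx t 0)).const_mul ε).sub
      (hφ.hasDerivAt_fst t 0)).eq_zero_of_forall_Ioo hbc0 ht
  · exact ((hφ.partialT.hasDerivAt_fst t (-1)).add (hx t (-1))).eq_zero_of_forall_Ioo hbc1 ht

/-- The energy `ε ‖∂ₓψ‖² + a ‖ψ‖² + |ψ(0)|²`. -/
def adjEnergy (ε a : ℝ) (ψ : ℝ → ℝ → ℝ) (t : ℝ) : ℝ :=
  ε * (∫ x in (-1 : ℝ)..0, partialX ψ t x ^ 2) + a * (∫ x in (-1 : ℝ)..0, ψ t x ^ 2) + ψ t 0 ^ 2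

namespace IsAdjSol1D

variable {T ε a t : ℝ} {ψ : ℝ → ℝ → ℝ}

lemma isSmooth (h : IsAdjSol1D T ε a ψ) : IsSmooth₂ ψ := h.1

lemma continuous_X1normSq (h : IsAdjSol1D T ε a ψ) : Continuous fun t => X1normSq ε (ψ t) := by
  have h1 := h.isSmooth.continuous_integral_sq (-1) 0
  have h2 := h.isSmooth.continuous_fst 0
  have h3 := h.isSmooth.continuous_fst (-1)
  unfold X1normSq
  fun_prop

lemma continuous_adjEnergy (h : IsAdjSol1D T ε a ψ) : Continuous (adjEnergy ε a ψ) := by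
  have h1 := h.isSmooth.continuous_integral_sq (-1) 0
  have h2 := h.isSmooth.partialX.continuous_integral_sq (-1) 0
  have h3 := h.isSmooth.continuous_fst 0
  unfold adjEnergy
  fun_prop

lemma hasDerivAt_X1normSq (h : IsAdjSol1D T ε a ψ) (ht : t ∈ Ioo 0 T) :
    HasDerivAt (fun t => X1normSq ε (ψ t))
      (2 * ((ψ t 0 ^ 2 + ψ t (-1) ^ 2) / 2 + ε * (∫ x in (-1 : ℝ)..0, partialX ψ t x ^ 2)
        + a * (∫ x in (-1 : ℝ)..0, ψ t x ^ 2))) t := by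
  have hψ := h.isSmooth
  refine ((hψ.hasDerivAt_integral_sq t (-1) 0).add
    ((((hψ.hasDerivAt_fst t 0).pow 2).add ((hψ.hasDerivAt_fst t (-1)).pow 2)).const_mul
      ε)).congr_deriv ?_
  have key := adjoint_identity_mul_self (fun x => hψ.hasDerivAt_snd t x)
    (fun x => hψ.partialX.hasDerivAt_snd t x) (hψ.partialT.continuous_snd t)
    (h.2.1 t ht) (h.2.2.1 t ht) (h.2.2.2 t ht)
  simp only [Nat.cast_ofNat, Nat.add_one_sub_one, pow_one]
  linear_combination 2 * key

lemma exists_hasDerivAt_adjEnergy (h : IsAdjSol1D T ε a ψ) (hε : 0 ≤ ε) (ht : t ∈ Ioo 0 T) :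
    ∃ F' : ℝ, HasDerivAt (adjEnergy ε a ψ) F' t ∧
      2 * (ε * _root_.partialT ψ t 0 ^ 2 - (∫ x in (-1 : ℝ)..0, partialX ψ t x ^ 2) / 4) ≤ F' := by
  have hψ := h.isSmooth
  refine ⟨_, (((hψ.partialX.hasDerivAt_integral_sq t (-1) 0).const_mul ε).add
    ((hψ.hasDerivAt_integral_sq t (-1) 0).const_mul a)).add ((hψ.hasDerivAt_fst t 0).pow 2), ?_⟩
  have key := adjoint_identity_mul_deriv (fun x => hψ.hasDerivAt_snd t x)
    (fun x => hψ.partialX.hasDerivAt_snd t x) (fun x => hψ.partialT.hasDerivAt_snd t x)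
    (hψ.partialT.partialX.continuous_snd t)
    (h.2.1 t ht) (h.2.2.1 t ht) (h.2.2.2 t ht)
  have hge := integral_sq_add_integral_mul_ge (hψ.partialX.continuous_snd t)
    (hψ.partialT.continuous_snd t)
  simp only [Nat.cast_ofNat, Nat.add_one_sub_one, pow_one, hψ.partialT_partialX]
  have hsq : 0 ≤ ε * _root_.partialT ψ t (-1) ^ 2 := by positivity
  change _ = (∫ x in (-1 : ℝ)..0, _root_.partialT ψ t x ^ 2)
    + (∫ x in (-1 : ℝ)..0, partialX ψ t x * _root_.partialT ψ t x)
    + ε * (_root_.partialT ψ t 0 ^ 2 + _root_.partialT ψ t (-1) ^ 2) at key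
  linear_combination 2 * hge + 2 * hsq - 2 * key

/-- The weighted boundary estimate, in terms of the time weight `timeWeight T c`. -/
lemma integral_timeWeight_le (h : IsAdjSol1D T ε a ψ) (ha : 0 ≤ a) (hε : ε ∈ Ioo (0 : ℝ) 1)
    (hT : 0 < T) {s c M : ℝ} (hs : T + T ^ 2 ≤ s) (hc : 0 ≤ c) (hM : 5 * s + c = M * s)
    (hM1 : 1 ≤ M) :
    ε ^ 2 * (∫ t in (0 : ℝ)..T, (t * (T - t)) ^ 4 * timeWeight T c t * _root_.partialT ψ t 0 ^ 2) ≤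
      M ^ 2 * s ^ 4 * ∫ t in (0 : ℝ)..T, timeWeight T c t *
        ((∫ x in (-1 : ℝ)..0, ψ t x ^ 2) + ε ^ 2 * (ψ t 0 ^ 2 + ψ t (-1) ^ 2)) := by
  have hψ := h.isSmooth
  have cw := continuousOn_timeWeight (T := T) hc
  have cI := (hψ.continuous_integral_sq (-1) 0).continuousOn (s := Icc 0 T)
  have c0 := (hψ.continuous_fst 0).continuousOn (s := Icc 0 T)
  have c1 := (hψ.continuous_fst (-1)).continuousOn (s := Icc 0 T)
  have cz := (hψ.partialT.continuous_fst 0).continuousOn (s := Icc 0 T)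
  have cE := h.continuous_X1normSq.continuousOn (s := Icc 0 T)
  have cF := h.continuous_adjEnergy.continuousOn (s := Icc 0 T)
  have cL : ContinuousOn (fun t => (t * (T - t)) ^ 4 * timeWeight T c t
      * _root_.partialT ψ t 0 ^ 2) (Icc 0 T) := by fun_prop
  have cR : ContinuousOn (fun t => timeWeight T c t *
      ((∫ x in (-1 : ℝ)..0, ψ t x ^ 2) + ε ^ 2 * (ψ t 0 ^ 2 + ψ t (-1) ^ 2))) (Icc 0 T) := by
    fun_prop
  choose! F' hF' hF'le using fun t (ht : t ∈ Ioo 0 T) =>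
    h.exists_hasDerivAt_adjEnergy hε.1.le ht
  have key := sub_le_integral_of_hasDeriv_right_of_le (a := 0) (b := T) hT.le
    (g := fun t => -(ε / 2 * ((t * (T - t)) ^ 4 * timeWeight T c t * adjEnergy ε a ψ t)
      + 1 / 2 * (((t * (T - t)) ^ 4 * timeWeight T c t
        + ε * (M * s * T * ((t * (T - t)) ^ 2 * timeWeight T c t))) * X1normSq ε (ψ t))))
    (φ := fun t => M ^ 2 * s ^ 4 * (timeWeight T c t *
        ((∫ x in (-1 : ℝ)..0, ψ t x ^ 2) + ε ^ 2 * (ψ t 0 ^ 2 + ψ t (-1) ^ 2)))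
      - ε ^ 2 * ((t * (T - t)) ^ 4 * timeWeight T c t * _root_.partialT ψ t 0 ^ 2))
    (by fun_prop)
    (fun t ht => by
      have w4 := hasDerivAt_pow_mul_timeWeight (c := c) 3 ht
      have w2 := hasDerivAt_pow_mul_timeWeight (c := c) 1 ht
      exact (((w4.mul (hF' t ht)).const_mul (ε / 2)).add
        (((w4.add ((w2.const_mul (M * s * T)).const_mul ε)).mul
          (h.hasDerivAt_X1normSq ht)).const_mul (1 / 2))).neg.hasDerivWithinAt)
    ((ContinuousOn.sub (by fun_prop) (by fun_prop)).integrableOn_Icc)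
    (fun t ht => by
      have hp := mul_sub_nonneg_of_mem_Icc (Ioo_subset_Icc_self ht)
      have hps : t * (T - t) ≤ s := by nlinarith [sq_nonneg t, ht.1, ht.2]
      have hq : |T - 2 * t| ≤ T := abs_le.2 ⟨by linarith [ht.2], by linarith [ht.1]⟩
      have hA : 0 ≤ ∫ x in (-1 : ℝ)..0, ψ t x ^ 2 :=
        intervalIntegral.integral_nonneg (by norm_num) fun x _ => sq_nonneg _
      have hD : 0 ≤ ∫ x in (-1 : ℝ)..0, partialX ψ t x ^ 2 :=
        intervalIntegral.integral_nonneg (by norm_num) fun x _ => sq_nonneg _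
      have hlow := lyapunov_deriv_lower_bound hε.1 hε.2 ha hT (by nlinarith) hp hps
        (Real.exp_pos (-c / (t * (T - t)))).le hq hc hM hM1 hA hD (sq_nonneg (ψ t 0))
        (sq_nonneg (ψ t (-1))) (hF'le t ht) rfl
      simp only [adjEnergy, X1normSq, timeWeight, Pi.add_apply] at hlow ⊢
      push_cast
      linear_combination hlow)
  rw [intervalIntegral.integral_sub
    ((cR.intervalIntegrable_of_Icc hT.le).const_mul _)
    ((cL.intervalIntegrable_of_Icc hT.le).const_mul _),
    intervalIntegral.integral_const_mul, intervalIntegral.integral_const_mul,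
    timeWeight_zero, timeWeight_self] at key
  linear_combination key

end IsAdjSol1D

/-- Weighted estimate of the second time derivative on the boundary. -/
theorem boundary_second_time_derivative_estimate :
    ∃ C > (0:ℝ), ∃ s0 > (0:ℝ), ∀ T > (0:ℝ), ∀ a ≥ (0:ℝ), ∀ ε ∈ Set.Ioo (0:ℝ) 1,
      ∀ s ≥ s0 * (T + T ^ 2),
      ∀ φ : ℝ → ℝ → ℝ, IsAdjSol1D T ε a φ →
        ε ^ 2 * (s ^ 5)⁻¹ * (∫ t in (0:ℝ)..T,
            (carlW T t (-1) ^ 5)⁻¹ * Real.exp (-2 * s * carlA T t (-1))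
              * (deriv (deriv (fun τ => φ τ 0)) t) ^ 2)
          ≤ C * (ε ^ 2 * s⁻¹ * (∫ t in (0:ℝ)..T,
                (carlW T t 0)⁻¹ * Real.exp (-2 * s * carlA T t 0)
                    * (deriv (fun τ => φ τ 0) t) ^ 2
                  + (carlW T t (-1))⁻¹ * Real.exp (-2 * s * carlA T t (-1))
                    * (deriv (fun τ => φ τ (-1)) t) ^ 2)
              + s⁻¹ * ∫ t in (0:ℝ)..T, ∫ x in (-1:ℝ)..0,
                  (carlW T t x)⁻¹ * Real.exp (-2 * s * carlA T t x)
                    * (deriv (fun τ => φ τ x) t) ^ 2) := by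
  have hexp : Real.exp 1 ≤ Real.exp 3 := Real.exp_le_exp.2 (by norm_num)
  set M : ℝ := 5 + 2 * (Real.exp 3 - Real.exp 1) with hMdef
  have hM1 : 1 ≤ M := by linarith
  refine ⟨M ^ 2 * Real.exp 2, by positivity, 1, one_pos, fun T hT a ha ε hε s hs φ hφ => ?_⟩
  rw [one_mul] at hs
  have hs0 : 0 < s := by nlinarith
  have hψ := hφ.partialT
  have hsm := hψ.isSmooth
  set ψ := partialT φ with hψdef
  set c : ℝ := 2 * s * (Real.exp 3 - Real.exp 1) with hcdef
  have hc : 0 ≤ c := mul_nonneg (by positivity) (sub_nonneg.2 hexp)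
  have main := hψ.integral_timeWeight_le ha hε hT hs hc (M := M) (by rw [hMdef, hcdef]; ring) hM1
  change ε ^ 2 * (s ^ 5)⁻¹ * (∫ t in (0:ℝ)..T,
      (carlW T t (-1) ^ 5)⁻¹ * Real.exp (-2 * s * carlA T t (-1)) * partialT ψ t 0 ^ 2) ≤
    M ^ 2 * Real.exp 2 * (ε ^ 2 * s⁻¹ * (∫ t in (0:ℝ)..T,
        (carlW T t 0)⁻¹ * Real.exp (-2 * s * carlA T t 0) * ψ t 0 ^ 2
          + (carlW T t (-1))⁻¹ * Real.exp (-2 * s * carlA T t (-1)) * ψ t (-1) ^ 2)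
      + s⁻¹ * ∫ t in (0:ℝ)..T, ∫ x in (-1:ℝ)..0,
          (carlW T t x)⁻¹ * Real.exp (-2 * s * carlA T t x) * ψ t x ^ 2)
  have cw := continuousOn_timeWeight (T := T) hc
  have cI := (hsm.continuous_integral_sq (-1) 0).continuousOn (s := Icc 0 T)
  have c0 := (hsm.continuous_fst 0).continuousOn (s := Icc 0 T)
  have c1 := (hsm.continuous_fst (-1)).continuousOn (s := Icc 0 T)
  have cz := (hsm.partialT.continuous_fst 0).continuousOn (s := Icc 0 T)
  have cL : ContinuousOn (fun t => (t * (T - t)) ^ 4 * timeWeight T c t * partialT ψ t 0 ^ 2)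
      (Icc 0 T) := by fun_prop
  have cR : ContinuousOn (fun t => timeWeight T c t *
      ((∫ x in (-1 : ℝ)..0, ψ t x ^ 2) + ε ^ 2 * (ψ t 0 ^ 2 + ψ t (-1) ^ 2))) (Icc 0 T) := by
    fun_prop
  have cB : ContinuousOn (fun t =>
      (carlW T t 0)⁻¹ * Real.exp (-2 * s * carlA T t 0) * ψ t 0 ^ 2
        + (carlW T t (-1))⁻¹ * Real.exp (-2 * s * carlA T t (-1)) * ψ t (-1) ^ 2) (Icc 0 T) :=
    ((continuousOn_carl hs0.le le_rfl).mul (c0.pow 2)).add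
      ((continuousOn_carl hs0.le (by norm_num)).mul (c1.pow 2))
  have iB := cB.intervalIntegrable_of_Icc (μ := volume) hT.le
  have iQ := intervalIntegrable_integral_carl hT.le hs0.le (u := fun t x => ψ t x ^ 2)
    (hsm.continuous.pow 2)
  have hL : (∫ t in (0:ℝ)..T,
      (carlW T t (-1) ^ 5)⁻¹ * Real.exp (-2 * s * carlA T t (-1)) * partialT ψ t 0 ^ 2) ≤
      ∫ t in (0:ℝ)..T, (t * (T - t)) ^ 4 * timeWeight T c t * partialT ψ t 0 ^ 2 := by
    simp only [carlW_pow_inv_mul_exp, ← hcdef, mul_assoc (Real.exp 1 ^ 5)⁻¹]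
    rw [intervalIntegral.integral_const_mul]
    refine mul_le_of_le_one_left (intervalIntegral.integral_nonneg hT.le fun t ht => ?_) ?_
    · have := timeWeight_nonneg c ht
      positivity
    · exact inv_le_one_of_one_le₀ (one_le_pow₀ (Real.one_le_exp zero_le_one))
  have hR : Real.exp (-2) * (∫ t in (0 : ℝ)..T, timeWeight T c t *
        ((∫ x in (-1 : ℝ)..0, ψ t x ^ 2) + ε ^ 2 * (ψ t 0 ^ 2 + ψ t (-1) ^ 2))) ≤
      (∫ t in (0:ℝ)..T, ∫ x in (-1:ℝ)..0,
          (carlW T t x)⁻¹ * Real.exp (-2 * s * carlA T t x) * ψ t x ^ 2)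
      + ε ^ 2 * (∫ t in (0:ℝ)..T,
        (carlW T t 0)⁻¹ * Real.exp (-2 * s * carlA T t 0) * ψ t 0 ^ 2
          + (carlW T t (-1))⁻¹ * Real.exp (-2 * s * carlA T t (-1)) * ψ t (-1) ^ 2) := by
    rw [← intervalIntegral.integral_const_mul, ← intervalIntegral.integral_const_mul,
      ← intervalIntegral.integral_add iQ (iB.const_mul _)]
    refine intervalIntegral.integral_mono_on hT.le
      ((continuousOn_const.mul cR).intervalIntegrable_of_Icc hT.le)
      (iQ.add (iB.const_mul _)) fun t ht => ?_
    have h0 := mul_le_mul_of_nonneg_right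
      (timeWeight_le_carl hs0.le ht (x := 0) (by norm_num)) (sq_nonneg (ψ t 0))
    have h1 := mul_le_mul_of_nonneg_right
      (timeWeight_le_carl hs0.le ht (x := -1) (by norm_num)) (sq_nonneg (ψ t (-1)))
    have hx : Real.exp (-2) * timeWeight T c t * (∫ x in (-1 : ℝ)..0, ψ t x ^ 2) ≤
        ∫ x in (-1:ℝ)..0, (carlW T t x)⁻¹ * Real.exp (-2 * s * carlA T t x) * ψ t x ^ 2 := by
      rw [← intervalIntegral.integral_const_mul]
      have cψ := (hsm.continuous_snd t).pow 2
      exact intervalIntegral.integral_mono_on (by norm_num)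
        ((continuous_const.mul cψ).intervalIntegrable _ _)
        (((continuous_carl_snd T s t).mul cψ).intervalIntegrable _ _) fun x hx =>
          mul_le_mul_of_nonneg_right (timeWeight_le_carl hs0.le ht hx) (sq_nonneg _)
    rw [← hcdef] at h0 h1
    linear_combination hx + ε ^ 2 * h0 + ε ^ 2 * h1
  have hee : Real.exp 2 * Real.exp (-2) = 1 := by rw [← Real.exp_add]; norm_num
  generalize (∫ t in (0:ℝ)..T, ∫ x in (-1:ℝ)..0,
          (carlW T t x)⁻¹ * Real.exp (-2 * s * carlA T t x) * ψ t x ^ 2) = Q at hR ⊢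
  generalize (∫ t in (0:ℝ)..T,
        (carlW T t 0)⁻¹ * Real.exp (-2 * s * carlA T t 0) * ψ t 0 ^ 2
          + (carlW T t (-1))⁻¹ * Real.exp (-2 * s * carlA T t (-1)) * ψ t (-1) ^ 2) = B at hR ⊢
  calc _ ≤ (s ^ 5)⁻¹ * (ε ^ 2 * ∫ t in (0:ℝ)..T,
        (t * (T - t)) ^ 4 * timeWeight T c t * partialT ψ t 0 ^ 2) := by
        rw [mul_comm (ε ^ 2), mul_assoc]
        gcongr
    _ ≤ (s ^ 5)⁻¹ * (M ^ 2 * s ^ 4 * ∫ t in (0 : ℝ)..T, timeWeight T c t *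
        ((∫ x in (-1 : ℝ)..0, ψ t x ^ 2) + ε ^ 2 * (ψ t 0 ^ 2 + ψ t (-1) ^ 2))) := by
        gcongr
    _ = M ^ 2 * Real.exp 2 * s⁻¹ * (Real.exp (-2) * ∫ t in (0 : ℝ)..T, timeWeight T c t *
        ((∫ x in (-1 : ℝ)..0, ψ t x ^ 2) + ε ^ 2 * (ψ t 0 ^ 2 + ψ t (-1) ^ 2))) := by
        rw [show (s ^ 5)⁻¹ = s⁻¹ * (s ^ 4)⁻¹ by rw [← mul_inv]; ring]
        have : (s ^ 4)⁻¹ * s ^ 4 = 1 := inv_mul_cancel₀ (by positivity)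
        generalize (∫ t in (0 : ℝ)..T, timeWeight T c t *
          ((∫ x in (-1 : ℝ)..0, ψ t x ^ 2) + ε ^ 2 * (ψ t 0 ^ 2 + ψ t (-1) ^ 2))) = J
        linear_combination s⁻¹ * M ^ 2 * J * this - M ^ 2 * s⁻¹ * J * hee
    _ ≤ M ^ 2 * Real.exp 2 * s⁻¹ * (Q + ε ^ 2 * B) := by gcongr
    _ = _ := by ring
end
end
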